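/- arXiv:2511.06347 — 14 statements merged into one kernel-verified Lean document; each statement's English description precedes it below -/
import Mathlib

section
/- Let φ(s) = u₂s² + u₁s + u₀ ∈ 𝔽_q[s] be a quadratic polynomial such that u₂ is a nonzero square in 𝔽_q and φ is not the square of a linear polynomial in 𝔽_q[s]. Let Z*_φ = {s ∈ 𝔽_q : φ(s) = y² for some y ∈ 𝔽_q \ {0}} and Z_φ = {s ∈ 𝔽_q : φ(s) = 0}. Then 2·|Z*_φ| = q − 1 − |Z_φ|. -/
open Polynomial

open Classical in
/-- In odd characteristic, a nonzero square has two square roots, `0` has one, and any other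
element has none. -/
theorem card_filter_sq_eq {F : Type*} [Field F] [Fintype F] (h2 : (2 : F) ≠ 0) (a : F) :
    (Finset.univ.filter fun y : F => y ^ 2 = a).card =
      2 * (if ∃ y : F, y ≠ 0 ∧ a = y ^ 2 then 1 else 0) + (if a = 0 then 1 else 0) := by
  by_cases ha : a = 0
  · subst ha
    have h1 : ¬ ∃ y : F, y ≠ 0 ∧ 0 = y ^ 2 := by
      rintro ⟨y, hy, h⟩
      exact pow_ne_zero 2 hy h.symm
    have h : (Finset.univ.filter fun y : F => y ^ 2 = 0) = {0} := by
      ext y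
      simp
    rw [h, if_neg h1]
    simp
  · by_cases hs : ∃ y : F, y ≠ 0 ∧ a = y ^ 2
    · rw [if_pos hs, if_neg ha]
      obtain ⟨y, hy, rfl⟩ := hs
      have h : (Finset.univ.filter fun z : F => z ^ 2 = y ^ 2) = {y, -y} := by
        ext z
        simp [sq_eq_sq_iff_eq_or_eq_neg]
      have hne : y ≠ -y := fun h => mul_ne_zero h2 hy (by linear_combination h)
      rw [h, Finset.card_pair hne]
    · rw [if_neg hs, if_neg ha, Finset.card_eq_zero, Finset.filter_eq_empty_iff]
      rintro y - rfl
      exact hs ⟨y, fun h => ha (by simp [h]), rfl⟩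

open Classical in
/-- The number of points on `y ^ 2 = f s`, in terms of the values of `f`. -/
theorem card_filter_sq_eq_apply {F : Type*} [Field F] [Fintype F] (h2 : (2 : F) ≠ 0)
    (f : F → F) :
    (Finset.univ.filter fun p : F × F => p.2 ^ 2 = f p.1).card =
      2 * {s : F | ∃ y : F, y ≠ 0 ∧ f s = y ^ 2}.ncard + {s : F | f s = 0}.ncard := by
  have h : (Finset.univ.filter fun p : F × F => p.2 ^ 2 = f p.1).card =
      ∑ s : F, (Finset.univ.filter fun y : F => y ^ 2 = f s).card := by
    simp only [Finset.card_filter, Fintype.sum_prod_type]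
  rw [h, Finset.sum_congr rfl fun s _ => card_filter_sq_eq h2 (f s), Finset.sum_add_distrib,
    ← Finset.mul_sum, ← Finset.card_filter, ← Finset.card_filter, Set.ncard_eq_toFinset_card',
    Set.ncard_eq_toFinset_card', Set.toFinset_ofPred, Set.toFinset_ofPred]

open Classical in
/-- The affine hyperbola `y ^ 2 = (c * s + d) ^ 2 + e` has `q - 1` points. -/
theorem card_filter_sq_eq_sq_add {F : Type*} [Field F] [Fintype F] (h2 : (2 : F) ≠ 0)
    {c e : F} (hc : c ≠ 0) (he : e ≠ 0) (d : F) :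
    (Finset.univ.filter fun p : F × F => p.2 ^ 2 = (c * p.1 + d) ^ 2 + e).card =
      Fintype.card F - 1 := by
  rw [← Finset.card_univ, ← Finset.card_erase_of_mem (Finset.mem_univ (0 : F))]
  have key : ∀ p : F × F, p.2 ^ 2 = (c * p.1 + d) ^ 2 + e → p.2 - (c * p.1 + d) ≠ 0 := by
    intro p hp h
    exact he (by linear_combination (p.2 + (c * p.1 + d)) * h - hp)
  refine Finset.card_nbij' (fun p => p.2 - (c * p.1 + d))
    (fun w => (((e / w - w) / 2 - d) / c, (e / w + w) / 2)) ?_ ?_ ?_ ?_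
  · intro p hp
    simpa using key p (by simpa using hp)
  · intro w hw
    have hw : w ≠ 0 := by simpa using hw
    simp only [Finset.coe_filter, Finset.mem_univ, true_and, Set.mem_ofPred_eq]
    field_simp
    ring
  · intro p hp
    have hp : p.2 ^ 2 = (c * p.1 + d) ^ 2 + e := by simpa using hp
    have hq : e / (p.2 - (c * p.1 + d)) = p.2 + (c * p.1 + d) := by
      rw [div_eq_iff (key p hp)]
      linear_combination -hp
    ext
    · simp only [hq]
      field_simp
      ring
    · simp only [hq]
      field_simp
      ring
  · intro w hw
    have hw : w ≠ 0 := by simpa using hw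
    dsimp only
    field_simp
    ring

/-- Let `φ(s) = u₂ s² + u₁ s + u₀` over a finite field `F` of characteristic ≠ 2,
with `u₂` a nonzero square and `φ` not the square of a linear polynomial. Then
`2 · |Z*_φ| = q − 1 − |Z_φ|`. -/
theorem stmt0 {F : Type*} [Field F] [Fintype F]
    (hchar : ringChar F ≠ 2)
    (u₂ u₁ u₀ : F)
    (hu₂ : ∃ y : F, y ≠ 0 ∧ u₂ = y ^ 2)
    (hφ : ∀ a b : F, (C u₂ * X ^ 2 + C u₁ * X + C u₀ : F[X]) ≠ (C a * X + C b) ^ 2) :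
    (2 * ({s : F | ∃ y : F, y ≠ 0 ∧ u₂ * s ^ 2 + u₁ * s + u₀ = y ^ 2}.ncard) : ℤ) =
      (Fintype.card F : ℤ) - 1 - ({s : F | u₂ * s ^ 2 + u₁ * s + u₀ = 0}.ncard : ℤ) := by
  classical
  have h2 : (2 : F) ≠ 0 := Ring.two_ne_zero hchar
  obtain ⟨c, hc, rfl⟩ := hu₂
  obtain ⟨d, rfl⟩ : ∃ d, u₁ = 2 * c * d := ⟨u₁ / (2 * c), by field_simp⟩
  obtain ⟨e, rfl⟩ : ∃ e, u₀ = d ^ 2 + e := ⟨u₀ - d ^ 2, by ring⟩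
  have he : e ≠ 0 := by
    rintro rfl
    refine hφ c d ?_
    simp only [map_mul, map_add, map_pow, map_ofNat, map_zero]
    ring
  have h := card_filter_sq_eq_sq_add h2 hc he d
  rw [card_filter_sq_eq_apply h2 fun s => (c * s + d) ^ 2 + e] at h
  have hsq : ∀ s, c ^ 2 * s ^ 2 + 2 * c * d * s + (d ^ 2 + e) = (c * s + d) ^ 2 + e :=
    fun s => by ring
  simp only [hsq]
  have hpos : 0 < Fintype.card F := Fintype.card_pos
  omega
end

section
/- There exists an element b ∈ 𝔽_q with b ≠ 0 such that the polynomial T³ + bT² + 1 is irreducible in 𝔽_q[T]. -/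
open Polynomial

/-- Over a finite field of characteristic ≠ 2, there exists `b ≠ 0` such that
`T³ + bT² + 1` is irreducible. -/
theorem stmt1 {F : Type*} [Field F] [Fintype F] (hchar : ringChar F ≠ 2) :
    ∃ b : F, b ≠ 0 ∧ Irreducible (X ^ 3 + C b * X ^ 2 + 1 : F[X]) := by
  -- For `x ≠ 0`, `f x` is the unique `b` such that `x` is a root of `T³ + bT² + 1`.
  let f : F → F := fun x ↦ -(x ^ 3 + 1) / x ^ 2
  have hf0 : f 0 = 0 := by simp [f]
  have hf1 : f (-1) = 0 := by simp [f, Odd.neg_one_pow (by decide : Odd 3)]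
  have hninj : ¬ Function.Injective f := fun h ↦
    one_ne_zero (neg_eq_zero.mp (h (hf1.trans hf0.symm)))
  have hnsurj : ¬ Function.Surjective f := fun h ↦ hninj (Finite.injective_iff_surjective.mpr h)
  obtain ⟨b, hb⟩ := not_forall.mp hnsurj
  refine ⟨b, fun h ↦ hb ⟨0, hf0.trans h.symm⟩, ?_⟩
  have hdeg : (X ^ 3 + C b * X ^ 2 + 1 : F[X]).natDegree = 3 := by compute_degree!
  rw [irreducible_iff_roots_eq_zero_of_degree_le_three (by omega) (by omega)]
  refine Multiset.eq_zero_of_forall_notMem fun x hx ↦ hb ⟨x, ?_⟩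
  have hroot : x ^ 3 + b * x ^ 2 + 1 = 0 := by
    simpa [IsRoot] using isRoot_of_mem_roots hx
  have hx0 : x ≠ 0 := by
    rintro rfl
    simp at hroot
  change -(x ^ 3 + 1) / x ^ 2 = b
  rw [div_eq_iff (pow_ne_zero 2 hx0)]
  linear_combination -hroot
end

section
/- Assume additionally that the characteristic of 𝔽_q is not 3. Then the set {(r,s) ∈ 𝔽_q × 𝔽_q : s ≠ 0, s ≠ 1, r ≠ s, and r² + (−4s³ + 6s² − 4s)·r + s⁴ = 0} has exactly q − 5 elements. -/
theorem two_ne_zero_and_three_ne_zero_of_ringChar {F : Type*} [Field F]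
    (h2 : ringChar F ≠ 2) (h3 : ringChar F ≠ 3) : (2 : F) ≠ 0 ∧ (3 : F) ≠ 0 := by
  refine ⟨Ring.two_ne_zero h2, fun h => ?_⟩
  have hdvd : ringChar F ∣ 3 := (ringChar.spec F 3).1 (by exact_mod_cast h)
  rcases (Nat.dvd_prime Nat.prime_three).1 hdvd with h1 | h1
  · exact CharP.ringChar_ne_one h1
  · exact h3 h1

/-- The number of nonzero parameters avoiding `±1` and `±3`. -/
theorem ncard_compl_zero_one_three {F : Type*} [Field F] [Fintype F]
    (h2 : (2 : F) ≠ 0) (h3 : (3 : F) ≠ 0) :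
    ({0, 1, -1, 3, -3}ᶜ : Set F).ncard = Fintype.card F - 5 := by
  classical
  have h4 : (4 : F) ≠ 0 := by convert mul_ne_zero h2 h2 using 1; norm_num
  have h6 : (6 : F) ≠ 0 := by convert mul_ne_zero h2 h3 using 1; norm_num
  have hcard : ({0, 1, -1, 3, -3} : Finset F).card = 5 := by
    rw [Finset.card_insert_of_notMem, Finset.card_insert_of_notMem,
      Finset.card_insert_of_notMem, Finset.card_insert_of_notMem, Finset.card_singleton] <;>
    · simp only [Finset.mem_insert, Finset.mem_singleton]
      grind
  rw [Set.ncard_compl, Nat.card_eq_fintype_card, ← hcard, ← Set.ncard_coe_finset]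
  simp

/-- On the curve `H = 0`, the parameter `u = (r - s) / (s (s - 1))` determines `s`. -/
theorem exists_cayley_parameter {F : Type*} [Field F] {r s : F}
    (hs : s ≠ 0) (hs1 : s - 1 ≠ 0) (hrs : r - s ≠ 0)
    (h : r ^ 2 + (-4 * s ^ 3 + 6 * s ^ 2 - 4 * s) * r + s ^ 4 = 0) :
    ∃ u, u = (r - s) / (s * (s - 1)) ∧ u ≠ 0 ∧ r = s + u * (s * (s - 1)) ∧
      (u - 1) * (u + 3) = s * (4 * u) := by
  have hss : s * (s - 1) ≠ 0 := mul_ne_zero hs hs1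
  obtain ⟨u, hu⟩ : ∃ u, u = (r - s) / (s * (s - 1)) := ⟨_, rfl⟩
  have hr : r = s + u * (s * (s - 1)) := by
    rw [hu, div_mul_cancel₀ _ hss]
    ring
  refine ⟨u, hu, hu ▸ div_ne_zero hrs hss, hr, ?_⟩
  have hz : s ^ 2 * (s - 1) ^ 2 * ((u - 1) * (u + 3) - s * (4 * u)) = 0 := by
    rw [hr] at h
    linear_combination h
  exact sub_eq_zero.1 ((mul_eq_zero.1 hz).resolve_left
    (mul_ne_zero (pow_ne_zero 2 hs) (pow_ne_zero 2 hs1)))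

/-- Each point of the curve `H = 0` with `s ∉ {0, 1}` and `r ≠ s` is parametrized by
`u = (r - s) / (s (s - 1))`. -/
theorem bijOn_cayley_curve {F : Type*} [Field F] (h2 : (2 : F) ≠ 0) :
    Set.BijOn
      (fun u : F => ((u - 1) ^ 3 * (u + 3) / (16 * u), (u - 1) * (u + 3) / (4 * u)))
      {0, 1, -1, 3, -3}ᶜ
      {p : F × F | p.2 ≠ 0 ∧ p.2 ≠ 1 ∧ p.1 ≠ p.2 ∧
        p.1 ^ 2 + (-4 * p.2 ^ 3 + 6 * p.2 ^ 2 - 4 * p.2) * p.1 + p.2 ^ 4 = 0} := by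
  have h4 : (4 : F) ≠ 0 := by convert mul_ne_zero h2 h2 using 1; norm_num
  have h16 : (16 : F) ≠ 0 := by convert mul_ne_zero h4 h4 using 1; norm_num
  refine Set.InvOn.bijOn (f' := fun p : F × F => (p.1 - p.2) / (p.2 * (p.2 - 1)))
    ⟨?_, ?_⟩ ?_ ?_
  · intro u hu
    simp only [Set.mem_compl_iff, Set.mem_insert_iff, Set.mem_singleton_iff, not_or] at hu
    obtain ⟨h0, h1, hn1, hu3, hn3⟩ := hu
    have hs : (u - 1) * (u + 3) / (4 * u) ≠ 0 :=
      div_ne_zero (mul_ne_zero (by grind) (by grind)) (mul_ne_zero h4 h0)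
    have hs' : (u - 1) * (u + 3) / (4 * u) - 1 ≠ 0 := by
      have : (u - 1) * (u + 3) / (4 * u) - 1 = (u - 3) * (u + 1) / (4 * u) := by
        field_simp; ring
      rw [this]
      exact div_ne_zero (mul_ne_zero (by grind) (by grind)) (mul_ne_zero h4 h0)
    dsimp only
    rw [div_eq_iff (mul_ne_zero hs hs')]
    field_simp
    ring
  · rintro ⟨r, s⟩ ⟨hs, hs1, hrs, h⟩
    dsimp only at hs hs1 hrs h ⊢
    have hs1 : s - 1 ≠ 0 := sub_ne_zero.2 hs1
    have hrs : r - s ≠ 0 := sub_ne_zero.2 hrs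
    obtain ⟨u, hu, hu0, hr, key⟩ := exists_cayley_parameter hs hs1 hrs h
    rw [← hu]
    refine Prod.ext ?_ ?_
    · dsimp only
      rw [div_eq_iff (mul_ne_zero h16 hu0), hr]
      linear_combination ((u - 1) ^ 2 + 4 * u * s) * key
    · dsimp only
      rw [div_eq_iff (mul_ne_zero h4 hu0), key]
  · intro u hu
    simp only [Set.mem_compl_iff, Set.mem_insert_iff, Set.mem_singleton_iff, not_or] at hu
    obtain ⟨h0, h1, hn1, hu3, hn3⟩ := hu
    have hs : (u - 1) * (u + 3) / (4 * u) ≠ 0 :=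
      div_ne_zero (mul_ne_zero (by grind) (by grind)) (mul_ne_zero h4 h0)
    have hd : (u - 3) * (u + 1) ≠ 0 := mul_ne_zero (by grind) (by grind)
    refine ⟨hs, fun h => hd ?_, fun h => mul_ne_zero hs hd ?_, ?_⟩
    · dsimp only at h
      rw [div_eq_iff (mul_ne_zero h4 h0)] at h
      linear_combination h
    · dsimp only at h
      have : (u - 1) * (u + 3) / (4 * u) * ((u - 3) * (u + 1)) =
          4 * ((u - 1) ^ 3 * (u + 3) / (16 * u) - (u - 1) * (u + 3) / (4 * u)) := by
        field_simp; ring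
      rw [this, h, sub_self, mul_zero]
    · dsimp only
      field_simp
      ring
  · rintro ⟨r, s⟩ ⟨hs, hs1, hrs, h⟩
    dsimp only at hs hs1 hrs h ⊢
    have hs1 : s - 1 ≠ 0 := sub_ne_zero.2 hs1
    have hrs : r - s ≠ 0 := sub_ne_zero.2 hrs
    obtain ⟨u, hu, hu0, -, key⟩ := exists_cayley_parameter hs hs1 hrs h
    rw [← hu]
    have hl : (u - 1) * (u + 3) ≠ 0 := key ▸ mul_ne_zero hs (mul_ne_zero h4 hu0)
    have hr : (u - 3) * (u + 1) ≠ 0 := by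
      have : (u - 3) * (u + 1) = (s - 1) * (4 * u) := by linear_combination key
      exact this ▸ mul_ne_zero hs1 (mul_ne_zero h4 hu0)
    rintro (h0 | h1 | hn1 | hu3 | hn3)
    · exact hu0 h0
    · exact hl (by rw [h1]; ring)
    · exact hr (by rw [hn1]; ring)
    · exact hr (by rw [hu3]; ring)
    · exact hl (by rw [Set.mem_singleton_iff.1 hn3]; ring)

/-- char ≠ 2, 3. The set of pairs `(r,s)` with `s ∉ {0,1}`, `r ≠ s` and
`r² + (−4s³ + 6s² − 4s)r + s⁴ = 0` has exactly `q − 5` elements. -/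
theorem stmt3 {F : Type*} [Field F] [Fintype F]
    (h2 : ringChar F ≠ 2) (h3 : ringChar F ≠ 3) :
    {p : F × F | p.2 ≠ 0 ∧ p.2 ≠ 1 ∧ p.1 ≠ p.2 ∧
      p.1 ^ 2 + (-4 * p.2 ^ 3 + 6 * p.2 ^ 2 - 4 * p.2) * p.1 + p.2 ^ 4 = 0}.ncard =
      Fintype.card F - 5 := by
  obtain ⟨h2, h3⟩ := two_ne_zero_and_three_ne_zero_of_ringChar h2 h3
  rw [← ncard_compl_zero_one_three h2 h3, ← (bijOn_cayley_curve h2).image_eq]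
  exact (bijOn_cayley_curve h2).injOn.ncard_image
end

section
/- Assume the characteristic of 𝔽_q is exactly 3 (so q is a power of 3). Then the set {(r,s) ∈ 𝔽_q × 𝔽_q : s ≠ 0, s ≠ 1, r ≠ s, and r² + (−4s³ + 6s² − 4s)·r + s⁴ = 0} has exactly q − 3 elements. -/
/-- char = 3. The set of pairs `(r,s)` with `s ∉ {0,1}`, `r ≠ s` and
`r² + (−4s³ + 6s² − 4s)r + s⁴ = 0` has exactly `q − 3` elements. -/
theorem stmt4 {F : Type*} [Field F] [Fintype F]
    (h2 : ringChar F ≠ 2) (h3 : ringChar F = 3) :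
    {p : F × F | p.2 ≠ 0 ∧ p.2 ≠ 1 ∧ p.1 ≠ p.2 ∧
      p.1 ^ 2 + (-4 * p.2 ^ 3 + 6 * p.2 ^ 2 - 4 * p.2) * p.1 + p.2 ^ 4 = 0}.ncard =
      Fintype.card F - 3 := by
  classical
  have three_eq_zero : (3 : F) = 0 := by
    have h := ringChar.Nat.cast_ringChar (R := F)
    rw [h3] at h
    exact_mod_cast h
  have one_ne_neg_one : (1 : F) ≠ -1 := (Ring.neg_one_ne_one_of_char_ne_two h2).symm
  -- In characteristic 3 the polynomial factors as `(r - s ^ 3) * (r - s)`.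
  have factor (r s : F) : r ^ 2 + (-4 * s ^ 3 + 6 * s ^ 2 - 4 * s) * r + s ^ 4 =
      (r - s ^ 3) * (r - s) := by
    linear_combination (-s ^ 3 + 2 * s ^ 2 - s) * r * three_eq_zero
  have cube_eq_self (s : F) : s ^ 3 = s ↔ s = 0 ∨ s = 1 ∨ s = -1 := by
    rw [← sub_eq_zero, show s ^ 3 - s = s * ((s - 1) * (s + 1)) by ring, mul_eq_zero,
      mul_eq_zero, sub_eq_zero, add_eq_zero_iff_eq_neg]
  have image_eq : {p : F × F | p.2 ≠ 0 ∧ p.2 ≠ 1 ∧ p.1 ≠ p.2 ∧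
      p.1 ^ 2 + (-4 * p.2 ^ 3 + 6 * p.2 ^ 2 - 4 * p.2) * p.1 + p.2 ^ 4 = 0} =
      (fun s : F ↦ (s ^ 3, s)) '' (({0, 1, -1}ᶜ : Finset F) : Set F) := by
    ext ⟨r, s⟩
    simp only [Set.mem_ofPred_eq, factor, mul_eq_zero, sub_eq_zero, Set.mem_image,
      Finset.mem_coe, Finset.mem_compl, Finset.mem_insert, Finset.mem_singleton,
      ← cube_eq_self, Prod.mk.injEq]
    constructor
    · rintro ⟨-, -, hrs, h⟩
      obtain rfl := h.resolve_right hrs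
      exact ⟨s, hrs, rfl, rfl⟩
    · rintro ⟨s, hs, rfl, rfl⟩
      refine ⟨?_, ?_, hs, Or.inl rfl⟩ <;> rintro rfl <;> simp at hs
  rw [image_eq, Set.ncard_image_of_injective _ fun _ _ h ↦ (Prod.mk.inj h).2,
    Set.ncard_coe_finset, Finset.card_compl,
    Finset.card_eq_three.mpr ⟨0, 1, -1, by simp, by simp, one_ne_neg_one, rfl⟩]
end

section
/- Assume additionally that the characteristic of 𝔽_q is not 3. Then the set {(r,s) ∈ 𝔽_q × 𝔽_q : r ≠ s, s² − s + (d + e − 4de) ≠ 0, and H(r,s) = 0} has exactly q − 5 elements, where H(r,s) = (1−4d)(1−4e)·r² + [−4s³ + 6s² + (−16de + 4d + 4e − 4)s + (−8de + 2d + 2e)]·r + [s⁴ + (24de − 6d − 6e)s² + (−16de + 4d + 4e)s + (−48d²e² + 24d²e + 24de² − 3d² − 6de − 3e²)]. -/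
open Polynomial

/-- In odd characteristic, irreducibility of `X² + X + d` forces its discriminant to be a
nonsquare. -/
lemma not_isSquare_one_sub_four_mul {F : Type*} [Field F] (h2 : (2 : F) ≠ 0) {d : F}
    (hd : Irreducible (X ^ 2 + X + C d : F[X])) : ¬ IsSquare (1 - 4 * d) := by
  rintro ⟨a, ha⟩
  have hdeg : (X ^ 2 + X + C d : F[X]).degree = 2 := by compute_degree!
  have hroot : (X ^ 2 + X + C d : F[X]).IsRoot ((a - 1) / 2) := by
    simp only [IsRoot.def, eval_add, eval_pow, eval_X, eval_C]
    field_simp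
    linear_combination -ha
  have h1 := degree_eq_one_of_irreducible_of_root hd hroot
  rw [hdeg] at h1
  norm_num at h1

lemma FiniteField.isSquare_mul_of_not_isSquare {F : Type*} [Field F] [Fintype F] {a b : F}
    (ha : ¬ IsSquare a) (hb : ¬ IsSquare b) : IsSquare (a * b) := by
  classical
  by_cases h0 : a * b = 0
  · simp [h0]
  · rw [← quadraticChar_one_iff_isSquare h0, map_mul,
      quadraticChar_neg_one_iff_not_isSquare.mpr ha, quadraticChar_neg_one_iff_not_isSquare.mpr hb]
    norm_num

/-- After normalisation, the Cayley curve is birational to the conic `t² - 2xt - 3 = 0`, which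
is parametrised by `t`. -/
lemma normalized_cayley_eq {F : Type*} [Field F] (h2 : (2 : F) ≠ 0) (x t : F) :
    4 * (x + (x ^ 2 - 1) * t / 2) ^ 2 - 4 * (x ^ 3 + x) * (x + (x ^ 2 - 1) * t / 2)
      + x ^ 4 + 6 * x ^ 2 - 3 = (x ^ 2 - 1) ^ 2 * (t ^ 2 - 2 * x * t - 3) := by
  field_simp
  ring

/-- The normalized 3-Poncelet pairs are parametrised by `t ∉ {0, ±1, ±3}`. -/
lemma ncard_normalized_cayley {F : Type*} [Field F] [Fintype F]
    (h2 : (2 : F) ≠ 0) (h3 : (3 : F) ≠ 0) :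
    {p : F × F | p.1 ≠ p.2 ∧ p.2 ^ 2 - 1 ≠ 0 ∧
      4 * p.1 ^ 2 - 4 * (p.2 ^ 3 + p.2) * p.1 + p.2 ^ 4 + 6 * p.2 ^ 2 - 3 = 0}.ncard =
      Fintype.card F - 5 := by
  classical
  have h4 : (4 : F) ≠ 0 := by
    have := mul_ne_zero h2 h2
    norm_num at this
    exact this
  have h6 : (6 : F) ≠ 0 := by
    have := mul_ne_zero h2 h3
    norm_num at this
    exact this
  let x : F → F := fun t => (t ^ 2 - 3) / (2 * t)
  let f : F → F × F := fun t => (x t + (x t ^ 2 - 1) * t / 2, x t)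
  let T : Finset F := {0, 1, -1, 3, -3}
  have hT : T.card = 5 := by
    have e1 : (1 : F) ≠ -1 := fun h => h2 (by linear_combination h)
    have e2 : (1 : F) ≠ 3 := fun h => h2 (by linear_combination -h)
    have e3 : (1 : F) ≠ -3 := fun h => h4 (by linear_combination h)
    have e4 : (-1 : F) ≠ 3 := fun h => h4 (by linear_combination -h)
    have e5 : (-1 : F) ≠ -3 := fun h => h2 (by linear_combination h)
    have e6 : (3 : F) ≠ -3 := fun h => h6 (by linear_combination h)
    repeat rw [Finset.card_insert_of_notMem]
    all_goals simp [e1, e2, e3, e4, e5, e6, h3, h3.symm]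
  have hx : ∀ t, t ≠ 0 → t ^ 2 - 2 * x t * t - 3 = 0 := by
    intro t ht
    simp only [x]
    field_simp
    ring
  have hfac : ∀ t, t ≠ 0 →
      4 * t ^ 2 * (x t ^ 2 - 1) = (t - 1) * (t + 1) * (t - 3) * (t + 3) := by
    intro t ht
    simp only [x]
    field_simp
    ring
  have hmem : ∀ t, t ∈ Tᶜ ↔ t ≠ 0 ∧ x t ^ 2 - 1 ≠ 0 := by
    intro t
    simp only [T, Finset.mem_compl, Finset.mem_insert, Finset.mem_singleton, not_or]
    refine and_congr_right fun ht => ?_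
    have h4t : 4 * t ^ 2 ≠ 0 := mul_ne_zero h4 (pow_ne_zero 2 ht)
    rw [← mul_ne_zero_iff_left (b := x t ^ 2 - 1) h4t, hfac t ht]
    simp only [ne_eq, mul_eq_zero, sub_eq_zero, add_eq_zero_iff_eq_neg, not_or]
    tauto
  have himage : {p : F × F | p.1 ≠ p.2 ∧ p.2 ^ 2 - 1 ≠ 0 ∧
      4 * p.1 ^ 2 - 4 * (p.2 ^ 3 + p.2) * p.1 + p.2 ^ 4 + 6 * p.2 ^ 2 - 3 = 0} =
      f '' ((Tᶜ : Finset F) : Set F) := by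
    ext ⟨b, a⟩
    simp only [Set.mem_ofPred_eq, Set.mem_image, Finset.mem_coe, hmem, f, Prod.mk.injEq]
    constructor
    · rintro ⟨hne, ha, hH⟩
      have hsub : b - a ≠ 0 := sub_ne_zero.mpr hne
      obtain ⟨t, ht⟩ : ∃ t, t = 2 * (b - a) / (a ^ 2 - 1) := ⟨_, rfl⟩
      have ht0 : t ≠ 0 := ht ▸ div_ne_zero (mul_ne_zero h2 hsub) ha
      have hb : a + (a ^ 2 - 1) * t / 2 = b := by
        rw [ht]
        field_simp
        ring
      have hq : t ^ 2 - 2 * a * t - 3 = 0 := by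
        rw [← hb, normalized_cayley_eq h2] at hH
        exact (mul_eq_zero.mp hH).resolve_left (pow_ne_zero 2 ha)
      have hxa : x t = a := by
        simp only [x]
        rw [div_eq_iff (mul_ne_zero h2 ht0)]
        linear_combination hq
      exact ⟨t, ⟨ht0, hxa ▸ ha⟩, hxa ▸ hb, hxa⟩
    · rintro ⟨t, ⟨ht0, ht⟩, rfl, rfl⟩
      refine ⟨?_, ht, ?_⟩
      · intro h
        have : (x t ^ 2 - 1) * t / 2 = 0 := by linear_combination h
        exact div_ne_zero (mul_ne_zero ht ht0) h2 this
      · rw [normalized_cayley_eq h2, hx t ht0, mul_zero]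
  have hinj : Set.InjOn f ((Tᶜ : Finset F) : Set F) := by
    intro t ht t' _ h
    obtain ⟨-, ht⟩ := (hmem t).mp ht
    simp only [f, Prod.mk.injEq] at h
    obtain ⟨h, hxx⟩ := h
    rw [← hxx] at h
    apply mul_left_cancel₀ ht
    field_simp at h
    linear_combination h
  rw [himage, hinj.ncard_image, Set.ncard_coe_finset, Finset.card_compl, hT]

/-- char ≠ 2, 3; `T² + T + d` and `T² + T + e` irreducible. The set of pairs
`(r,s)` with `r ≠ s`, `s² − s + (d + e − 4de) ≠ 0` and `H(r,s) = 0` (the Cayley coefficient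
`H₂` for the pencil `𝒫₁₆`) has exactly `q − 5` elements. -/
theorem stmt5 {F : Type*} [Field F] [Fintype F]
    (h2 : ringChar F ≠ 2) (h3 : ringChar F ≠ 3) (d e : F)
    (hd : Irreducible (X ^ 2 + X + C d : F[X]))
    (he : Irreducible (X ^ 2 + X + C e : F[X])) :
    {p : F × F | p.1 ≠ p.2 ∧ p.2 ^ 2 - p.2 + (d + e - 4 * d * e) ≠ 0 ∧
      (1 - 4 * d) * (1 - 4 * e) * p.1 ^ 2 +
        (-4 * p.2 ^ 3 + 6 * p.2 ^ 2 + (-16 * d * e + 4 * d + 4 * e - 4) * p.2 +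
          (-8 * d * e + 2 * d + 2 * e)) * p.1 +
        (p.2 ^ 4 + (24 * d * e - 6 * d - 6 * e) * p.2 ^ 2 +
          (-16 * d * e + 4 * d + 4 * e) * p.2 +
          (-48 * d ^ 2 * e ^ 2 + 24 * d ^ 2 * e + 24 * d * e ^ 2 - 3 * d ^ 2 -
            6 * d * e - 3 * e ^ 2)) = 0}.ncard =
      Fintype.card F - 5 := by
  have h2' : (2 : F) ≠ 0 := Ring.two_ne_zero h2
  have h3' : (3 : F) ≠ 0 := by
    intro h
    have hdvd : ringChar F ∣ 3 := (ringChar.spec F 3).mp (by exact_mod_cast h)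
    rcases (Nat.dvd_prime Nat.prime_three).mp hdvd with h1 | h1
    · exact CharP.ringChar_ne_one h1
    · exact h3 h1
  have hA := not_isSquare_one_sub_four_mul h2' hd
  have hB := not_isSquare_one_sub_four_mul h2' he
  obtain ⟨c, hc⟩ := FiniteField.isSquare_mul_of_not_isSquare hA hB
  have hc0 : c ≠ 0 := by
    rintro rfl
    rcases mul_eq_zero.mp (hc.trans (mul_zero 0)) with h | h
    · exact hA (h ▸ IsSquare.zero)
    · exact hB (h ▸ IsSquare.zero)
  have h16 : (16 : F) ≠ 0 := by
    have := pow_ne_zero 4 h2'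
    norm_num at this
    exact this
  have h4 : (4 : F) ≠ 0 := by
    have := pow_ne_zero 2 h2'
    norm_num at this
    exact this
  let φ : F → F := fun r => (2 * r - 1) / c
  have hφ : ∀ r, c * φ r = 2 * r - 1 := fun r => mul_div_cancel₀ _ hc0
  have hφbij : Function.Bijective φ := by
    refine Finite.injective_iff_bijective.mp fun r r' h => mul_left_cancel₀ h2' ?_
    have := hφ r
    rw [h, hφ r'] at this
    linear_combination -this
  rw [← ncard_normalized_cayley h2' h3']
  refine Eq.trans ?_ (Set.ncard_preimage_of_injective_subset_range
    (hφbij.injective.prodMap hφbij.injective)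
    (by simp [(hφbij.surjective.prodMap hφbij.surjective).range_eq]))
  congr 1
  ext ⟨r, s⟩
  simp only [Set.mem_ofPred_eq, Set.mem_preimage, Prod.map_apply, hφbij.injective.ne_iff]
  have hr := hφ r
  have hs := hφ s
  generalize φ r = y at hr
  generalize φ s = x at hs
  have hr' : r = (c * y + 1) / 2 := by field_simp; linear_combination -hr
  have hs' : s = (c * x + 1) / 2 := by field_simp; linear_combination -hs
  have hsmooth : 4 * (s ^ 2 - s + (d + e - 4 * d * e)) = c ^ 2 * (x ^ 2 - 1) := by
    rw [hs']
    field_simp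
    linear_combination -4 * hc
  refine and_congr_right fun _ => and_congr ?_ ?_
  · rw [← mul_ne_zero_iff_left h4, hsmooth, mul_ne_zero_iff_left (pow_ne_zero 2 hc0)]
  · have hm : 1 - 4 * (d + e - 4 * d * e) = c ^ 2 := by linear_combination hc
    have hm' : d + e - 4 * d * e = (1 - c ^ 2) / 4 := by
      rw [eq_div_iff h4]
      linear_combination -hm
    have hH : (1 - 4 * d) * (1 - 4 * e) * r ^ 2 +
        (-4 * s ^ 3 + 6 * s ^ 2 + (-16 * d * e + 4 * d + 4 * e - 4) * s +
          (-8 * d * e + 2 * d + 2 * e)) * r +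
        (s ^ 4 + (24 * d * e - 6 * d - 6 * e) * s ^ 2 +
          (-16 * d * e + 4 * d + 4 * e) * s +
          (-48 * d ^ 2 * e ^ 2 + 24 * d ^ 2 * e + 24 * d * e ^ 2 - 3 * d ^ 2 -
            6 * d * e - 3 * e ^ 2)) =
        (1 - 4 * (d + e - 4 * d * e)) * r ^ 2 +
          (-4 * s ^ 3 + 6 * s ^ 2 + (4 * (d + e - 4 * d * e) - 4) * s +
            2 * (d + e - 4 * d * e)) * r +
          (s ^ 4 - 6 * (d + e - 4 * d * e) * s ^ 2 + 4 * (d + e - 4 * d * e) * s -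
            3 * (d + e - 4 * d * e) ^ 2) := by ring
    have key : 16 * ((1 - 4 * (d + e - 4 * d * e)) * r ^ 2 +
          (-4 * s ^ 3 + 6 * s ^ 2 + (4 * (d + e - 4 * d * e) - 4) * s +
            2 * (d + e - 4 * d * e)) * r +
          (s ^ 4 - 6 * (d + e - 4 * d * e) * s ^ 2 + 4 * (d + e - 4 * d * e) * s -
            3 * (d + e - 4 * d * e) ^ 2)) =
        c ^ 4 * (4 * y ^ 2 - 4 * (x ^ 3 + x) * y + x ^ 4 + 6 * x ^ 2 - 3) := by
      rw [hm', hr', hs']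
      field_simp
      ring
    rw [hH, ← mul_eq_zero_iff_left h16, key, mul_eq_zero_iff_left (pow_ne_zero 4 hc0)]
end

section
/- The set {(r,s) ∈ 𝔽_q × 𝔽_q : r ≠ s and (1−4e)·r² + (−4e²s³ + 6es² + 4es − 4s + 2)·r + (e²s⁴ − 6es² + 4s − 3) = 0} has exactly q − 1 elements. (This holds both when the characteristic of 𝔽_q is 3 and when it is different from 3.) -/
open Polynomial

/-- If `T² + T + e` is irreducible, then its discriminant `1 - 4e` is not a square. -/
lemma not_isSquare_of_irreducible {F : Type*} [Field F] (h2 : (2 : F) ≠ 0) {e : F}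
    (he : Irreducible (X ^ 2 + X + C e : F[X])) : ¬ IsSquare (1 - 4 * e) := by
  rintro ⟨d, hd⟩
  have hdeg : (X ^ 2 + X + C e : F[X]).degree = 2 := by compute_degree!
  have hroot : (X ^ 2 + X + C e : F[X]).IsRoot ((d - 1) / 2) := by
    simp only [IsRoot.def, eval_add, eval_pow, eval_X, eval_C]
    field_simp
    linear_combination -hd
  have := degree_eq_one_of_irreducible_of_root he hroot
  rw [hdeg] at this
  exact absurd this (by decide)

/-- On the curve, `m = (1 - 4e)(r - s) / (es² - s + 1)` satisfies a quadratic equation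
which is linear in `s`. -/
lemma mul_cayley_eq {F : Type*} [Field F] {e r s m : F}
    (h : (1 - 4 * e) * (r - s) = m * (e * s ^ 2 - s + 1)) :
    (1 - 4 * e) * ((1 - 4 * e) * r ^ 2 +
        (-4 * e ^ 2 * s ^ 3 + 6 * e * s ^ 2 + 4 * e * s - 4 * s + 2) * r +
        (e ^ 2 * s ^ 4 - 6 * e * s ^ 2 + 4 * s - 3)) =
      (e * s ^ 2 - s + 1) ^ 2 * (m ^ 2 - 2 * m * (2 * e * s - 1) - 3 * (1 - 4 * e)) := by
  linear_combination ((1 - 4 * e) * (r - s) + m * (e * s ^ 2 - s + 1) -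
    2 * (e * s ^ 2 - s + 1) * (2 * e * s - 1)) * h

theorem stmt7 {F : Type*} [Field F] [Fintype F]
    (h2 : ringChar F ≠ 2) (e : F)
    (he : Irreducible (X ^ 2 + X + C e : F[X])) :
    {p : F × F | p.1 ≠ p.2 ∧
      (1 - 4 * e) * p.1 ^ 2 +
        (-4 * e ^ 2 * p.2 ^ 3 + 6 * e * p.2 ^ 2 + 4 * e * p.2 - 4 * p.2 + 2) * p.1 +
        (e ^ 2 * p.2 ^ 4 - 6 * e * p.2 ^ 2 + 4 * p.2 - 3) = 0}.ncard =
      Fintype.card F - 1 := by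
  classical
  have two_ne : (2 : F) ≠ 0 := Ring.two_ne_zero h2
  have hsq := not_isSquare_of_irreducible two_ne he
  have hA : 1 - 4 * e ≠ 0 := fun h => hsq (h ▸ IsSquare.zero)
  have he0 : e ≠ 0 := by
    rintro rfl
    exact hsq (by simp)
  have hP (s : F) : e * s ^ 2 - s + 1 ≠ 0 := fun h =>
    hsq ⟨2 * e * s - 1, by linear_combination -4 * e * h⟩
  let S : Fˣ → F := fun m => (m ^ 2 + 2 * m - 3 * (1 - 4 * e)) / (4 * e * m)
  let f : Fˣ → F × F := fun m =>
    (S m + m * (e * S m ^ 2 - S m + 1) / (1 - 4 * e), S m)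
  have h4 : (4 : F) ≠ 0 := by
    rw [show (4 : F) = 2 * 2 by norm_num]
    exact mul_ne_zero two_ne two_ne
  have hS (m : Fˣ) : (m : F) ^ 2 - 2 * m * (2 * e * S m - 1) - 3 * (1 - 4 * e) = 0 := by
    have hm := m.ne_zero
    have : S m * (4 * e * m) = m ^ 2 + 2 * m - 3 * (1 - 4 * e) :=
      div_mul_cancel₀ _ (mul_ne_zero (mul_ne_zero h4 he0) hm)
    linear_combination -this
  have hf (m : Fˣ) : (1 - 4 * e) * ((f m).1 - (f m).2) =
      m * (e * (f m).2 ^ 2 - (f m).2 + 1) := by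
    simp only [f, add_sub_cancel_left]
    exact mul_div_cancel₀ _ hA
  have hinj : Function.Injective f := by
    intro m n hmn
    have hm := hf m
    rw [hmn, hf n] at hm
    exact Units.ext (mul_right_cancel₀ (hP _) hm).symm
  have hrange : {p : F × F | p.1 ≠ p.2 ∧
      (1 - 4 * e) * p.1 ^ 2 +
        (-4 * e ^ 2 * p.2 ^ 3 + 6 * e * p.2 ^ 2 + 4 * e * p.2 - 4 * p.2 + 2) * p.1 +
        (e ^ 2 * p.2 ^ 4 - 6 * e * p.2 ^ 2 + 4 * p.2 - 3) = 0} = Set.range f := by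
    ext ⟨r, s⟩
    constructor
    · rintro ⟨hne, h⟩
      dsimp only at hne h
      have hm0 : (1 - 4 * e) * (r - s) / (e * s ^ 2 - s + 1) ≠ 0 :=
        div_ne_zero (mul_ne_zero hA (sub_ne_zero.2 hne)) (hP s)
      obtain ⟨m, hm⟩ : ∃ m : Fˣ, (m : F) = (1 - 4 * e) * (r - s) / (e * s ^ 2 - s + 1) :=
        ⟨Units.mk0 _ hm0, rfl⟩
      have hrs : (1 - 4 * e) * (r - s) = m * (e * s ^ 2 - s + 1) := by
        rw [hm, div_mul_cancel₀ _ (hP s)]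
      have key := mul_cayley_eq hrs
      rw [h, mul_zero, eq_comm, mul_eq_zero, or_iff_right (pow_ne_zero 2 (hP s))] at key
      have hs : S m = s := by
        refine (div_eq_iff (mul_ne_zero (mul_ne_zero h4 he0) m.ne_zero)).2 ?_
        linear_combination key
      refine ⟨m, Prod.ext ?_ hs⟩
      simp only [f, hs]
      rw [← hrs, mul_div_cancel_left₀ _ hA, add_sub_cancel]
    · rintro ⟨m, hm⟩
      have hrs := hf m
      have hSm := hS m
      have hs : S m = s := congrArg Prod.snd hm
      rw [hm] at hrs
      rw [hs] at hSm
      dsimp only at hrs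
      refine ⟨fun heq => ?_, ?_⟩
      · dsimp only at heq
        rw [heq, sub_self, mul_zero] at hrs
        exact mul_ne_zero m.ne_zero (hP s) hrs.symm
      · have key := mul_cayley_eq hrs
        rw [hSm, mul_zero] at key
        exact (mul_eq_zero.1 key).resolve_left hA
  rw [hrange, ← Set.image_univ, Set.ncard_image_of_injective _ hinj, Set.ncard_univ,
    Nat.card_eq_fintype_card, Fintype.card_units]
end

section
/- The set {(r,s) ∈ 𝔽_q × 𝔽_q : r ≠ s and (ρ² − 4νσ²)·r² + (−4ν²s³ − 6νρs² + (4νσ² − 4ρ²)s − 2ρσ²)·r + (ν²s⁴ − 6νσ²s² − 4ρσ²s − 3σ⁴) = 0} has exactly q − 1 elements. (This holds both when the characteristic of 𝔽_q is 3 and when it is different from 3.) -/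
theorem quadratic_ne_zero_of_discrim_nonsquare {F : Type*} [CommRing F] {ν ρ σ : F}
    (hρ : ¬ ∃ y : F, ρ ^ 2 - 4 * ν * σ ^ 2 = y ^ 2) (s : F) :
    ν * s ^ 2 + ρ * s + σ ^ 2 ≠ 0 :=
  fun h => hρ ⟨2 * ν * s + ρ, by linear_combination (-4 * ν) * h⟩

/-- Expansion of the Cayley coefficient in powers of `r - s`. -/
theorem cayley_coefficient_eq {F : Type*} [CommRing F] (ν ρ σ r s : F) :
    (ρ ^ 2 - 4 * ν * σ ^ 2) * r ^ 2 +
        (-4 * ν ^ 2 * s ^ 3 - 6 * ν * ρ * s ^ 2 +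
          (4 * ν * σ ^ 2 - 4 * ρ ^ 2) * s - 2 * ρ * σ ^ 2) * r +
        (ν ^ 2 * s ^ 4 - 6 * ν * σ ^ 2 * s ^ 2 - 4 * ρ * σ ^ 2 * s - 3 * σ ^ 4) =
      (ρ ^ 2 - 4 * ν * σ ^ 2) * (r - s) ^ 2 -
        2 * (r - s) * (ν * s ^ 2 + ρ * s + σ ^ 2) * (2 * ν * s + ρ) -
        3 * (ν * s ^ 2 + ρ * s + σ ^ 2) ^ 2 := by
  ring

/-- `ν` and `ρ² − 4νσ²` non-squares. The set of pairs `(r,s)` with `r ≠ s` and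
`(ρ²−4νσ²)r² + (−4ν²s³ − 6νρs² + (4νσ²−4ρ²)s − 2ρσ²)r + (ν²s⁴ − 6νσ²s² − 4ρσ²s − 3σ⁴) = 0`
has exactly `q − 1` elements (in any characteristic ≠ 2). -/
theorem stmt8 {F : Type*} [Field F] [Fintype F]
    (h2 : ringChar F ≠ 2) (ν ρ σ : F)
    (hν : ¬ ∃ y : F, ν = y ^ 2)
    (hρ : ¬ ∃ y : F, ρ ^ 2 - 4 * ν * σ ^ 2 = y ^ 2) :
    {p : F × F | p.1 ≠ p.2 ∧
      (ρ ^ 2 - 4 * ν * σ ^ 2) * p.1 ^ 2 +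
        (-4 * ν ^ 2 * p.2 ^ 3 - 6 * ν * ρ * p.2 ^ 2 +
          (4 * ν * σ ^ 2 - 4 * ρ ^ 2) * p.2 - 2 * ρ * σ ^ 2) * p.1 +
        (ν ^ 2 * p.2 ^ 4 - 6 * ν * σ ^ 2 * p.2 ^ 2 - 4 * ρ * σ ^ 2 * p.2 - 3 * σ ^ 4) = 0}.ncard =
      Fintype.card F - 1 := by
  have two_ne : (2 : F) ≠ 0 := Ring.two_ne_zero h2
  have ν_ne : ν ≠ 0 := fun h => hν ⟨0, by simp [h]⟩
  have disc_ne : ρ ^ 2 - 4 * ν * σ ^ 2 ≠ 0 := fun h => hρ ⟨0, by simp [h]⟩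
  have Q_ne := quadratic_ne_zero_of_discrim_nonsquare hρ
  set A := ρ ^ 2 - 4 * ν * σ ^ 2 with hA
  let S : F → F := fun u => ((u ^ 2 - 3 * A) / (2 * u) - ρ) / (2 * ν)
  have S_spec (u : F) (hu : u ≠ 0) : 2 * u * (2 * ν * S u + ρ) = u ^ 2 - 3 * A := by
    simp only [S]
    field_simp
    ring
  let Q : F → F := fun s => ν * s ^ 2 + ρ * s + σ ^ 2
  let g : F → F × F := fun u => (S u + u * Q (S u) / A, S u)
  have g_spec (u : F) : A * ((g u).1 - (g u).2) = u * Q (g u).2 := by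
    simp only [g]
    field_simp
    ring
  have g_inj : Set.InjOn g {0}ᶜ := by
    intro u _ v _ huv
    have hu := g_spec u
    rw [huv, g_spec v] at hu
    exact (mul_right_cancel₀ (Q_ne _) hu).symm
  have card_compl : ({0}ᶜ : Set F).ncard = Fintype.card F - 1 := by
    rw [Set.ncard_compl, Set.ncard_singleton, Nat.card_eq_fintype_card]
  rw [← card_compl, ← g_inj.ncard_image]
  congr 1
  ext ⟨r, s⟩
  simp only [Set.mem_ofPred_eq, Set.mem_image, Set.mem_compl_iff, Set.mem_singleton_iff]
  rw [hA, cayley_coefficient_eq, ← hA]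
  constructor
  · rintro ⟨hrs, hH⟩
    have hrs' : r - s ≠ 0 := sub_ne_zero.mpr hrs
    have hQ : Q s ≠ 0 := Q_ne s
    obtain ⟨u, hu⟩ : ∃ u, u * Q s = A * (r - s) := ⟨A * (r - s) / Q s, div_mul_cancel₀ _ hQ⟩
    have u_ne : u ≠ 0 := by
      rintro rfl
      rw [zero_mul] at hu
      exact mul_ne_zero disc_ne hrs' hu.symm
    have hs : 2 * u * (2 * ν * s + ρ) = u ^ 2 - 3 * A := by
      apply mul_right_cancel₀ (pow_ne_zero 2 hQ)
      change A * (r - s) ^ 2 - 2 * (r - s) * Q s * (2 * ν * s + ρ) - 3 * Q s ^ 2 = 0 at hH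
      linear_combination (-A) * hH + (2 * Q s * (2 * ν * s + ρ) - u * Q s - A * (r - s)) * hu
    have hSs : S u = s := by
      apply mul_left_cancel₀ (mul_ne_zero (mul_ne_zero two_ne u_ne) (mul_ne_zero two_ne ν_ne))
      linear_combination S_spec u u_ne - hs
    refine ⟨u, u_ne, ?_⟩
    simp only [g, hSs, hu, mul_div_cancel_left₀ _ disc_ne, add_sub_cancel]
  · rintro ⟨u, u_ne, hg⟩
    have hu := g_spec u
    have hs : 2 * u * (2 * ν * s + ρ) = u ^ 2 - 3 * A := by
      rw [← show S u = s from congrArg Prod.snd hg]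
      exact S_spec u u_ne
    rw [hg] at hu
    have hQ : Q s ≠ 0 := Q_ne s
    dsimp only at hu
    refine ⟨?_, ?_⟩
    · rintro rfl
      rw [sub_self, mul_zero] at hu
      exact mul_ne_zero u_ne hQ hu.symm
    · change A * (r - s) ^ 2 - 2 * (r - s) * Q s * (2 * ν * s + ρ) - 3 * Q s ^ 2 = 0
      apply mul_left_cancel₀ disc_ne
      linear_combination
        (A * (r - s) + u * Q s - 2 * Q s * (2 * ν * s + ρ)) * hu - Q s ^ 2 * hs
end

section
/- Assume additionally that the characteristic of 𝔽_q is not 3. Then N₁ + N₂ + N₃ = q + 1, where N₁ = |{(r,s) ∈ 𝔽_q × 𝔽_q : r ≠ s and H(r,s) = 0}|, N₂ = |{r ∈ 𝔽_q : 3r² + 2br + (−b² + 4c) = 0}|, and N₃ = |{s ∈ 𝔽_q : 3s⁴ + 4bs³ + 6cs² + 12s + (4b − c²) = 0}|. -/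
open Polynomial

theorem three_ne_zero_of_ringChar_ne {F : Type*} [Field F] (h3 : ringChar F ≠ 3) : (3 : F) ≠ 0 := by
  intro h
  have h' : ringChar F ∣ 3 := ringChar.dvd (by exact_mod_cast h)
  rcases (Nat.dvd_prime Nat.prime_three).1 h' with h1 | h1
  · exact CharP.ringChar_ne_one h1
  · exact h3 h1

section
variable {F : Type*} [Field F] [Fintype F] [DecidableEq F]

theorem quadraticChar_sq_mul {a : F} (ha : a ≠ 0) (x : F) :
    quadraticChar F (a ^ 2 * x) = quadraticChar F x := by
  rw [map_mul, quadraticChar_sq_one' ha, one_mul]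

theorem ncard_sq_eq (h2 : ringChar F ≠ 2) (a : F) :
    ({x : F | x ^ 2 = a}.ncard : ℤ) = quadraticChar F a + 1 := by
  rw [← quadraticChar_card_sqrts h2, Set.ncard_eq_toFinset_card']

/-- The number of roots of a nonzero binary quadratic form on the projective line. -/
theorem ncard_quadratic_roots (h2 : ringChar F ≠ 2) {a b c : F}
    (h : ¬(a = 0 ∧ b = 0 ∧ c = 0)) :
    ({x : F | a * x ^ 2 + b * x + c = 0}.ncard : ℤ) + (if a = 0 then 1 else 0) =
      1 + quadraticChar F (b ^ 2 - 4 * a * c) := by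
  have h2' : (2 : F) ≠ 0 := Ring.two_ne_zero h2
  by_cases ha : a = 0
  · subst ha
    by_cases hb : b = 0
    · subst hb
      have hc : c ≠ 0 := by simpa using h
      simp [hc]
    · have hs : {x : F | 0 * x ^ 2 + b * x + c = 0} = {-c / b} := by
        ext x
        simp only [Set.mem_ofPred_eq, Set.mem_singleton_iff, eq_div_iff hb]
        constructor <;> intro h <;> linear_combination h
      rw [hs, Set.ncard_singleton]
      simp [quadraticChar_sq_one' hb]
  · rw [if_neg ha, add_zero, add_comm, ← ncard_sq_eq h2]
    have h4 : 4 * a ≠ 0 := by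
      rw [show (4 : F) = 2 * 2 by norm_num]; exact mul_ne_zero (mul_ne_zero h2' h2') ha
    norm_cast
    refine Set.ncard_congr (fun x _ => 2 * a * x + b) ?_ ?_ ?_
    · intro x hx
      simp only [Set.mem_ofPred_eq] at hx ⊢
      linear_combination 4 * a * hx
    · intro x y _ _ hxy
      exact mul_left_cancel₀ (mul_ne_zero h2' ha) (add_right_cancel hxy)
    · intro y hy
      have hx : 2 * a * ((y - b) / (2 * a)) + b = y := by field_simp; ring
      refine ⟨(y - b) / (2 * a), ?_, hx⟩
      simp only [Set.mem_ofPred_eq] at hy ⊢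
      generalize (y - b) / (2 * a) = x at hx
      subst hx
      exact (mul_eq_zero.1 (show 4 * a * (a * x ^ 2 + b * x + c) = 0 by
        linear_combination hy)).resolve_left h4

theorem sum_quadraticChar_sq_sub (h2 : ringChar F ≠ 2) {d : F} (hd : d ≠ 0) :
    ∑ x : F, quadraticChar F (x ^ 2 - d) = -1 := by
  have h2' : (2 : F) ≠ 0 := Ring.two_ne_zero h2
  have hcard : Fintype.card {p : F × F // p.2 ^ 2 = p.1 ^ 2 - d} = Fintype.card Fˣ := by
    refine Fintype.card_congr
      { toFun := fun p => Units.mk0 (p.1.1 + p.1.2) fun h => hd (by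
          linear_combination (p.1.1 - p.1.2) * h + p.2)
        invFun := fun u => ⟨((u + d / u) / 2, (u - d / u) / 2), by
          have := u.ne_zero
          field_simp
          ring⟩
        left_inv := ?_
        right_inv := ?_ }
    · rintro ⟨⟨x, y⟩, h⟩
      have hxy : x + y ≠ 0 := fun h' => hd (by linear_combination (x - y) * h' + h)
      have hdiv : d / (x + y) = x - y := by
        rw [div_eq_iff hxy]; linear_combination h
      ext
      · simp only [Units.val_mk0, hdiv]
        field_simp; ring
      · simp only [Units.val_mk0, hdiv]
        field_simp; ring
    · intro u
      ext
      simp only [Units.val_mk0]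
      field_simp; ring
  have hsum : (Fintype.card {p : F × F // p.2 ^ 2 = p.1 ^ 2 - d} : ℤ) =
      ∑ x : F, (quadraticChar F (x ^ 2 - d) + 1) := by
    rw [Fintype.card_subtype, Finset.card_filter, Fintype.sum_prod_type, Nat.cast_sum]
    refine Finset.sum_congr rfl fun x _ => ?_
    rw [← quadraticChar_card_sqrts h2, ← Finset.card_filter]
    congr 2
    ext; simp
  rw [hcard, Fintype.card_units, Finset.sum_add_distrib,
    Nat.cast_sub Fintype.card_pos] at hsum
  simp only [Finset.sum_const, Finset.card_univ, nsmul_eq_mul, mul_one, Nat.cast_one] at hsum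
  linarith

theorem sum_quadraticChar_quadratic (h2 : ringChar F ≠ 2) {a b c : F}
    (hd : b ^ 2 - 4 * a * c ≠ 0) :
    ∑ x : F, quadraticChar F (a * x ^ 2 + b * x + c) = -quadraticChar F a := by
  have h2' : (2 : F) ≠ 0 := Ring.two_ne_zero h2
  by_cases ha : a = 0
  · subst ha
    have hb : b ≠ 0 := by rintro rfl; simp at hd
    rw [quadraticChar_zero, neg_zero, ← quadraticChar_sum_zero h2]
    refine Fintype.sum_equiv ((Equiv.mulLeft₀ b hb).trans (Equiv.addRight c)) _ _ fun x => ?_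
    simp
  · have hsum := sum_quadraticChar_sq_sub h2 hd
    rw [← Fintype.sum_equiv ((Equiv.mulLeft₀ (2 * a) (mul_ne_zero h2' ha)).trans
      (Equiv.addRight b)) (fun x => quadraticChar F a * quadraticChar F (a * x ^ 2 + b * x + c)) _
      fun x => ?_, ← Finset.mul_sum] at hsum
    · linear_combination quadraticChar F a * hsum -
        (∑ x : F, quadraticChar F (a * x ^ 2 + b * x + c)) * quadraticChar_sq_one ha
    · rw [← map_mul, ← quadraticChar_sq_mul h2']
      congr 1
      simp
      ring
end

/-- A binary cubic form without rational zeros has nonzero Hessian discriminant. -/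
theorem hessian_discrim_ne_zero {F : Type*} [Field F] (h2 : (2 : F) ≠ 0) (h3 : (3 : F) ≠ 0)
    {b c : F} (hf : ∀ s : F, s ^ 3 + b * s ^ 2 + c * s + 1 ≠ 0) :
    (b * c - 9) ^ 2 - 4 * (b ^ 2 - 3 * c) * (c ^ 2 - 3 * b) ≠ 0 := by
  intro h
  by_cases ha : b ^ 2 - 3 * c = 0
  · have hbc : b * c - 9 = 0 := by
      rw [ha] at h; simpa using h
    refine hf (-b / 3) ?_
    field_simp
    linear_combination 2 * b * ha - 3 * hbc
  · have h8 : (2 * (b ^ 2 - 3 * c)) ≠ 0 := mul_ne_zero h2 ha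
    obtain ⟨s, hs⟩ : ∃ s, 2 * (b ^ 2 - 3 * c) * s = 9 - b * c :=
      ⟨_, mul_div_cancel₀ _ h8⟩
    refine hf s ((mul_eq_zero.1 (?_ : 3 * (2 * (b ^ 2 - 3 * c)) ^ 3 *
      (s ^ 3 + b * s ^ 2 + c * s + 1) = 0)).resolve_left (mul_ne_zero h3 (pow_ne_zero 3 h8)))
    linear_combination (27 + 2 * b ^ 3 - 9 * b * c) * h + 3 * (
      ((2 * (b ^ 2 - 3 * c) * s) ^ 2 + 2 * (b ^ 2 - 3 * c) * s * (9 - b * c) + (9 - b * c) ^ 2) +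
      2 * (b ^ 2 - 3 * c) * b * (2 * (b ^ 2 - 3 * c) * s + (9 - b * c)) +
      (2 * (b ^ 2 - 3 * c)) ^ 2 * c) * hs

theorem cubic_ne_zero_of_irreducible {F : Type*} [Field F] {b c : F}
    (hirr : Irreducible (X ^ 3 + C b * X ^ 2 + C c * X + 1 : F[X])) (s : F) :
    s ^ 3 + b * s ^ 2 + c * s + 1 ≠ 0 := by
  intro h
  have hdeg := degree_eq_one_of_irreducible_of_root hirr (x := s) (by simpa [IsRoot] using h)
  have : (X ^ 3 + C b * X ^ 2 + C c * X + 1 : F[X]).degree = 3 := by compute_degree!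
  rw [this] at hdeg
  norm_num at hdeg

/-- char ≠ 2, 3; `T³ + bT² + cT + 1` irreducible. For the Cayley coefficient
`H₂` of the pencil `𝒫₁₈`, the count `N₁ + N₂ + N₃` equals `q + 1`. -/
theorem stmt9 {F : Type*} [Field F] [Fintype F]
    (h2 : ringChar F ≠ 2) (h3 : ringChar F ≠ 3) (b c : F)
    (hirr : Irreducible (X ^ 3 + C b * X ^ 2 + C c * X + 1 : F[X])) :
    {p : F × F | p.1 ≠ p.2 ∧
        (3 * p.2 ^ 4 + 4 * b * p.2 ^ 3 + 6 * c * p.2 ^ 2 + 12 * p.2 + (4 * b - c ^ 2)) * p.1 ^ 2 +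
          (2 * b * p.2 ^ 4 + (4 * b ^ 2 - 4 * c) * p.2 ^ 3 + (6 * b * c - 18) * p.2 ^ 2 +
            (-4 * b + 4 * c ^ 2) * p.2 + 2 * c) * p.1 +
          ((-b ^ 2 + 4 * c) * p.2 ^ 4 + 12 * p.2 ^ 3 + 6 * b * p.2 ^ 2 + 4 * c * p.2 + 3) = 0}.ncard +
      {r : F | 3 * r ^ 2 + 2 * b * r + (-b ^ 2 + 4 * c) = 0}.ncard +
      {s : F | 3 * s ^ 4 + 4 * b * s ^ 3 + 6 * c * s ^ 2 + 12 * s + (4 * b - c ^ 2) = 0}.ncard =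
      Fintype.card F + 1 := by
  classical
  have h2' : (2 : F) ≠ 0 := Ring.two_ne_zero h2
  have h3' : (3 : F) ≠ 0 := three_ne_zero_of_ringChar_ne h3
  have h4 : (4 : F) ≠ 0 := by rw [show (4 : F) = 2 * 2 by norm_num]; exact mul_ne_zero h2' h2'
  have hf := cubic_ne_zero_of_irreducible hirr
  let u : F → F := fun s => 3 * s ^ 4 + 4 * b * s ^ 3 + 6 * c * s ^ 2 + 12 * s + (4 * b - c ^ 2)
  let v : F → F := fun s => 2 * b * s ^ 4 + (4 * b ^ 2 - 4 * c) * s ^ 3 +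
    (6 * b * c - 18) * s ^ 2 + (-4 * b + 4 * c ^ 2) * s + 2 * c
  let w : F → F := fun s =>
    (-b ^ 2 + 4 * c) * s ^ 4 + 12 * s ^ 3 + 6 * b * s ^ 2 + 4 * c * s + 3
  have hdiag (s : F) : u s * s ^ 2 + v s * s + w s ≠ 0 := by
    have : u s * s ^ 2 + v s * s + w s = 3 * (s ^ 3 + b * s ^ 2 + c * s + 1) ^ 2 := by
      simp only [u, v, w]; ring
    rw [this]
    exact mul_ne_zero h3' (pow_ne_zero 2 (hf s))
  have hfiber (s : F) :
      ({r : F | u s * r ^ 2 + v s * r + w s = 0}.ncard : ℤ) + (if u s = 0 then 1 else 0) =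
        1 + quadraticChar F ((b ^ 2 - 3 * c) * s ^ 2 + (b * c - 9) * s + (c ^ 2 - 3 * b)) := by
    rw [ncard_quadratic_roots h2, ← quadraticChar_sq_mul (mul_ne_zero h4 (hf s))
      ((b ^ 2 - 3 * c) * s ^ 2 + _ * s + _)]
    · congr 2
      simp only [u, v, w]; ring
    · rintro ⟨h, h', h''⟩
      exact hdiag s (by simp [h, h', h''])
  have hinf : ({r : F | 3 * r ^ 2 + 2 * b * r + (-b ^ 2 + 4 * c) = 0}.ncard : ℤ) =
      1 + quadraticChar F (b ^ 2 - 3 * c) := by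
    have h := ncard_quadratic_roots h2 (a := 3) (b := 2 * b) (c := -b ^ 2 + 4 * c)
      (fun h => h3' h.1)
    rw [if_neg h3', add_zero] at h
    rw [h, ← quadraticChar_sq_mul h4 (b ^ 2 - 3 * c)]
    congr 2
    ring
  have hpairs : ({p : F × F | p.1 ≠ p.2 ∧ u p.2 * p.1 ^ 2 + v p.2 * p.1 + w p.2 = 0}.ncard : ℤ) =
      ∑ s, ({r : F | u s * r ^ 2 + v s * r + w s = 0}.ncard : ℤ) := by
    have hset : {p : F × F | p.1 ≠ p.2 ∧ u p.2 * p.1 ^ 2 + v p.2 * p.1 + w p.2 = 0} =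
        {p : F × F | u p.2 * p.1 ^ 2 + v p.2 * p.1 + w p.2 = 0} := by
      ext ⟨r, s⟩
      refine and_iff_right_of_imp ?_
      rintro h (rfl : r = s)
      exact hdiag r h
    simp only [hset, Set.ncard_eq_toFinset_card', Set.toFinset_ofPred, Finset.card_filter]
    rw [Fintype.sum_prod_type_right]
    push_cast
    rfl
  have hpoly : ({s : F | u s = 0}.ncard : ℤ) = ∑ s, if u s = 0 then 1 else 0 := by
    simp [Set.ncard_eq_toFinset_card']
  have hsum := Finset.sum_congr (rfl : (Finset.univ : Finset F) = _) fun s _ => hfiber s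
  rw [Finset.sum_add_distrib, Finset.sum_add_distrib, ← hpairs, ← hpoly,
    sum_quadraticChar_quadratic h2 (hessian_discrim_ne_zero h2' h3' hf)] at hsum
  simp only [Finset.sum_const, Finset.card_univ, nsmul_eq_mul, mul_one] at hsum
  zify
  linear_combination hsum + hinf
end

section
/- Assume the characteristic of 𝔽_q is exactly 3 (so q is a power of 3). Then N₁ + N₂ + N₃ = q, where N₁ = |{(r,s) ∈ 𝔽_q × 𝔽_q : r ≠ s and H(r,s) = 0}|, N₂ = |{r ∈ 𝔽_q : 3r² + 2br + (−b² + 4c) = 0}|, and N₃ = |{s ∈ 𝔽_q : 3s⁴ + 4bs³ + 6cs² + 12s + (4b − c²) = 0}|. -/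
open Polynomial

/-- In characteristic 3 the Cayley coefficient `H₂` is divisible by `r - s`. -/
theorem cayley_factor {F : Type*} [Field F] (h3 : (3 : F) = 0) (b c r s : F) :
    (3 * s ^ 4 + 4 * b * s ^ 3 + 6 * c * s ^ 2 + 12 * s + (4 * b - c ^ 2)) * r ^ 2 +
      (2 * b * s ^ 4 + (4 * b ^ 2 - 4 * c) * s ^ 3 + (6 * b * c - 18) * s ^ 2 +
        (-4 * b + 4 * c ^ 2) * s + 2 * c) * r +
      ((-b ^ 2 + 4 * c) * s ^ 4 + 12 * s ^ 3 + 6 * b * s ^ 2 + 4 * c * s + 3) =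
    (r - s) * ((b * s ^ 3 + b - c ^ 2) * r + ((b ^ 2 - c) * s ^ 3 - c)) := by
  linear_combination (s ^ 4 * r ^ 2 + b * s ^ 3 * r ^ 2 + 2 * c * s ^ 2 * r ^ 2 + 4 * s * r ^ 2 +
    b * r ^ 2 + b * s ^ 4 * r + (b ^ 2 - c) * s ^ 3 * r + (2 * b * c - 6) * s ^ 2 * r +
    (-b + c ^ 2) * s * r + c * r + c * s ^ 4 + 4 * s ^ 3 + 2 * b * s ^ 2 + c * s + 1) * h3

/-- Off the diagonal the zeros of `H₂` form the graph over `s` of a Möbius function of `s ^ 3`. -/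
theorem ncard_offDiag_zeros {F : Type*} [Field F] {b c : F}
    (hroot : ∀ s : F, s ^ 3 + b * s ^ 2 + c * s + 1 ≠ 0)
    (hcop : ∀ s : F, b * s ^ 3 + b - c ^ 2 = 0 → (b ^ 2 - c) * s ^ 3 - c ≠ 0) :
    {p : F × F | p.1 ≠ p.2 ∧ (p.1 - p.2) *
      ((b * p.2 ^ 3 + b - c ^ 2) * p.1 + ((b ^ 2 - c) * p.2 ^ 3 - c)) = 0}.ncard =
    {s : F | b * s ^ 3 + b - c ^ 2 ≠ 0 ∧ b * s - c ≠ 0}.ncard := by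
  have himage : {p : F × F | p.1 ≠ p.2 ∧ (p.1 - p.2) *
      ((b * p.2 ^ 3 + b - c ^ 2) * p.1 + ((b ^ 2 - c) * p.2 ^ 3 - c)) = 0} =
      (fun s ↦ (-((b ^ 2 - c) * s ^ 3 - c) / (b * s ^ 3 + b - c ^ 2), s)) ''
        {s : F | b * s ^ 3 + b - c ^ 2 ≠ 0 ∧ b * s - c ≠ 0} := by
    ext ⟨r, s⟩
    simp only [Set.mem_ofPred_eq, Set.mem_image, Prod.mk.injEq]
    constructor
    · rintro ⟨hne, h⟩
      have hlin := (mul_eq_zero.mp h).resolve_left (sub_ne_zero.mpr hne)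
      have hA : b * s ^ 3 + b - c ^ 2 ≠ 0 := by
        intro hA
        exact hcop s hA (by simpa [hA] using hlin)
      have hr : -((b ^ 2 - c) * s ^ 3 - c) / (b * s ^ 3 + b - c ^ 2) = r := by
        rw [div_eq_iff hA]
        linear_combination -hlin
      refine ⟨s, ⟨hA, fun hs ↦ hne ?_⟩, hr, rfl⟩
      rw [← hr, div_eq_iff hA]
      linear_combination -(s ^ 3 + b * s ^ 2 + c * s + 1) * hs
    · rintro ⟨s, ⟨hA, hs⟩, rfl, rfl⟩
      constructor
      · intro heq
        rw [div_eq_iff hA] at heq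
        refine mul_ne_zero (hroot s) hs ?_
        linear_combination -heq
      · rw [mul_div_cancel₀ _ hA]
        ring
  rw [himage, Set.ncard_image_of_injective]
  intro s t h
  exact (Prod.mk.inj h).2

/-- char = 3; `T³ + bT² + cT + 1` irreducible. For the Cayley coefficient
`H₂` of the pencil `𝒫₁₈`, the count `N₁ + N₂ + N₃` equals `q`. -/
theorem stmt10 {F : Type*} [Field F] [Fintype F]
    (h2 : ringChar F ≠ 2) (h3 : ringChar F = 3) (b c : F)
    (hirr : Irreducible (X ^ 3 + C b * X ^ 2 + C c * X + 1 : F[X])) :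
    {p : F × F | p.1 ≠ p.2 ∧
        (3 * p.2 ^ 4 + 4 * b * p.2 ^ 3 + 6 * c * p.2 ^ 2 + 12 * p.2 + (4 * b - c ^ 2)) * p.1 ^ 2 +
          (2 * b * p.2 ^ 4 + (4 * b ^ 2 - 4 * c) * p.2 ^ 3 + (6 * b * c - 18) * p.2 ^ 2 +
            (-4 * b + 4 * c ^ 2) * p.2 + 2 * c) * p.1 +
          ((-b ^ 2 + 4 * c) * p.2 ^ 4 + 12 * p.2 ^ 3 + 6 * b * p.2 ^ 2 + 4 * c * p.2 + 3) = 0}.ncard +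
      {r : F | 3 * r ^ 2 + 2 * b * r + (-b ^ 2 + 4 * c) = 0}.ncard +
      {s : F | 3 * s ^ 4 + 4 * b * s ^ 3 + 6 * c * s ^ 2 + 12 * s + (4 * b - c ^ 2) = 0}.ncard =
      Fintype.card F := by
  have h30 : (3 : F) = 0 := by
    have := CharP.cast_eq_zero F (ringChar F)
    rw [h3] at this
    exact_mod_cast this
  have hroot := cubic_ne_zero_of_irreducible hirr
  have hcop (s : F) (hA : b * s ^ 3 + b - c ^ 2 = 0) (hs : b * s - c = 0) : False := by
    have hb : b ≠ 0 := by
      rintro rfl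
      apply hroot (-1)
      linear_combination hs
    refine mul_ne_zero hb (hroot s) ?_
    linear_combination hA - (b * s + c + b * s) * hs + b ^ 2 * s ^ 2 * h30
  have hA (s : F) : 3 * s ^ 4 + 4 * b * s ^ 3 + 6 * c * s ^ 2 + 12 * s + (4 * b - c ^ 2) =
      b * s ^ 3 + b - c ^ 2 := by
    linear_combination (s ^ 4 + b * s ^ 3 + 2 * c * s ^ 2 + 4 * s + b) * h30
  have hB (r : F) : 3 * r ^ 2 + 2 * b * r + (-b ^ 2 + 4 * c) = -(b * r - (c - b ^ 2)) := by
    linear_combination (r ^ 2 + b * r + c) * h30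
  simp_rw [cayley_factor h30, hA, hB, neg_eq_zero]
  rw [ncard_offDiag_zeros hroot fun s hs hD ↦ hcop s hs <|
    (mul_eq_zero.mp (by linear_combination s * hs + hD :
      (s ^ 3 + b * s ^ 2 + c * s + 1) * (b * s - c) = 0)).resolve_left (hroot s)]
  by_cases hb : b = 0
  · subst hb
    have hc : c ≠ 0 := by
      rintro rfl
      apply hroot (-1)
      ring
    simp [hc]
  · have : CharP F 3 := ringChar.of_eq h3
    have : Fact (Nat.Prime 3) := ⟨Nat.prime_three⟩
    have hinj := frobenius_inj F 3
    obtain ⟨s₀, hs₀⟩ := (Finite.injective_iff_surjective.mp hinj) ((c ^ 2 - b) / b)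
    rw [frobenius_def, eq_div_iff hb] at hs₀
    have hAs (s : F) : b * s ^ 3 + b - c ^ 2 = 0 ↔ s = s₀ := by
      constructor
      · intro h
        apply hinj
        simp only [frobenius_def]
        apply mul_left_cancel₀ hb
        linear_combination h - hs₀
      · rintro rfl
        linear_combination hs₀
    have hlin (d x : F) : b * x - d = 0 ↔ x = d / b := by
      rw [sub_eq_zero, eq_div_iff hb, mul_comm]
    have hne : s₀ ≠ c / b := fun h ↦ hcop s₀ ((hAs s₀).mpr rfl) ((hlin c s₀).mpr h)
    simp only [ne_eq, hAs, hlin, Set.ofPred_eq_eq_singleton, Set.ncard_singleton]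
    have hcompl : {s : F | ¬s = s₀ ∧ ¬s = c / b} = ({s₀, c / b} : Set F)ᶜ := by
      ext s
      simp
    have hcard := Set.ncard_add_ncard_compl ({s₀, c / b} : Set F)
    rw [Set.ncard_pair hne, Nat.card_eq_fintype_card] at hcard
    rw [hcompl]
    omega
end

section
/- The set S = {(r,s) ∈ 𝔽_q × 𝔽_q : s ≠ 0, s ≠ 1, r ≠ s, and (r − s²)·((2s−1)r − s²)·(r + s² − 2s) = 0} has exactly 3q − 7 elements, and the subset of S consisting of pairs with additionally r ≠ 0 and r ≠ 1 has exactly 3q − 9 elements. -/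
theorem ne_inv_two_iff {F : Type*} [Field F] (h2 : (2 : F) ≠ 0) {s : F} :
    s ≠ 2⁻¹ ↔ 2 * s - 1 ≠ 0 := by
  rw [not_iff_not, sub_eq_zero, ← mul_eq_one_iff_eq_inv₀ h2, mul_comm]

/-- For `s ∉ {0, 1}`, the zeros `r ≠ s` of the Cayley coefficient `H₃` lie on three explicit
graphs over the `s`-line, the second of which is undefined at `s = 1 / 2`. -/
theorem cayley_zero_iff {F : Type*} [Field F] (h2 : (2 : F) ≠ 0) {r s : F} :
    (s ≠ 0 ∧ s ≠ 1 ∧ r ≠ s ∧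
      (r - s ^ 2) * ((2 * s - 1) * r - s ^ 2) * (r + s ^ 2 - 2 * s) = 0) ↔
    (s ≠ 0 ∧ s ≠ 1) ∧
      (r = s ^ 2 ∨ (s ≠ 2⁻¹ ∧ r = s ^ 2 / (2 * s - 1)) ∨ r = 2 * s - s ^ 2) := by
  rw [ne_inv_two_iff h2]
  constructor
  · rintro ⟨h0, h1, -, h⟩
    refine ⟨⟨h0, h1⟩, ?_⟩
    rcases mul_eq_zero.1 h with h | h
    · rcases mul_eq_zero.1 h with h | h
      · exact Or.inl (sub_eq_zero.1 h)
      · have hs : 2 * s - 1 ≠ 0 := by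
          intro hs
          rw [hs, zero_mul, zero_sub, neg_eq_zero] at h
          exact h0 (pow_eq_zero_iff two_ne_zero |>.1 h)
        refine Or.inr (Or.inl ⟨hs, ?_⟩)
        rw [eq_div_iff hs]
        linear_combination h
    · exact Or.inr (Or.inr (by linear_combination h))
  · rintro ⟨⟨h0, h1⟩, h⟩
    have hne : s * (s - 1) ≠ 0 := mul_ne_zero h0 (sub_ne_zero.2 h1)
    refine ⟨h0, h1, ?_⟩
    rcases h with rfl | ⟨hs, h⟩ | rfl
    · exact ⟨fun h => hne (by linear_combination h), by ring⟩
    · rw [eq_div_iff hs] at h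
      refine ⟨?_, ?_⟩
      · rintro rfl
        exact hne (by linear_combination h)
      · linear_combination (r - s ^ 2) * (r + s ^ 2 - 2 * s) * h
    · exact ⟨fun h => hne (by linear_combination -h), by ring⟩

theorem ncard_cayley_zero {F : Type*} [Field F] [Fintype F] (h2 : (2 : F) ≠ 0) :
    {p : F × F | p.2 ≠ 0 ∧ p.2 ≠ 1 ∧ p.1 ≠ p.2 ∧
        (p.1 - p.2 ^ 2) * ((2 * p.2 - 1) * p.1 - p.2 ^ 2) *
          (p.1 + p.2 ^ 2 - 2 * p.2) = 0}.ncard = 3 * Fintype.card F - 7 := by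
  classical
  have half0 : (2⁻¹ : F) ≠ 0 := inv_ne_zero h2
  have half1 : (2⁻¹ : F) ≠ 1 := by
    rw [Ne, inv_eq_one]
    exact fun h => one_ne_zero (α := F) (by linear_combination h)
  let T : Finset F := {0, 1}ᶜ
  let T' : Finset F := {0, 1, 2⁻¹}ᶜ
  have card_three : ({0, 1, 2⁻¹} : Finset F).card = 3 :=
    Finset.card_eq_three.2 ⟨0, 1, 2⁻¹, zero_ne_one, half0.symm, half1.symm, rfl⟩
  have three_le : 3 ≤ Fintype.card F := card_three ▸ Finset.card_le_univ _
  have cardT : T.card = Fintype.card F - 2 := by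
    rw [Finset.card_compl, Finset.card_pair zero_ne_one]
  have cardT' : T'.card = Fintype.card F - 3 := by
    rw [Finset.card_compl, card_three]
  have inj (f : F → F) : Function.Injective fun s => (f s, s) :=
    fun _ _ h => (Prod.ext_iff.1 h).2
  let A := T.image fun s => (s ^ 2, s)
  let B := T'.image fun s => (s ^ 2 / (2 * s - 1), s)
  let C := T.image fun s => (2 * s - s ^ 2, s)
  have sq_ne {s : F} (h : s ≠ 1) : (s - 1) ^ 2 ≠ 0 := pow_ne_zero 2 (sub_ne_zero.2 h)
  have hAB : Disjoint A B := by
    simp only [Finset.disjoint_left, A, B, T, T', Finset.mem_image, Finset.mem_compl,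
      Finset.mem_insert, Finset.mem_singleton, not_or, not_exists, not_and]
    rintro _ ⟨s, -, rfl⟩ t ⟨h0, h1, hh⟩ h
    obtain ⟨h, rfl⟩ := Prod.ext_iff.1 h
    dsimp only at h0 h1 hh h
    rw [div_eq_iff ((ne_inv_two_iff h2).1 hh)] at h
    exact mul_ne_zero (mul_ne_zero h2 (pow_ne_zero 2 h0)) (sub_ne_zero.2 h1)
      (by linear_combination -h)
  have hABC : Disjoint (A ∪ B) C := by
    simp only [Finset.disjoint_right, A, B, C, T, T', Finset.mem_union, Finset.mem_image,
      Finset.mem_compl, Finset.mem_insert, Finset.mem_singleton, not_or, not_exists, not_and]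
    rintro _ ⟨s, ⟨h0, h1⟩, rfl⟩
    constructor
    · rintro t - h
      obtain ⟨h, rfl⟩ := Prod.ext_iff.1 h
      dsimp only at h0 h1 h
      exact mul_ne_zero (mul_ne_zero h2 h0) (sub_ne_zero.2 h1) (by linear_combination h)
    · rintro t ⟨-, -, hh⟩ h
      obtain ⟨h, rfl⟩ := Prod.ext_iff.1 h
      dsimp only at h0 h1 hh h
      rw [div_eq_iff ((ne_inv_two_iff h2).1 hh)] at h
      exact mul_ne_zero (mul_ne_zero h2 h0) (sq_ne h1) (by linear_combination h)
  have hS : {p : F × F | p.2 ≠ 0 ∧ p.2 ≠ 1 ∧ p.1 ≠ p.2 ∧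
      (p.1 - p.2 ^ 2) * ((2 * p.2 - 1) * p.1 - p.2 ^ 2) *
        (p.1 + p.2 ^ 2 - 2 * p.2) = 0} = ((A ∪ B ∪ C : Finset (F × F)) : Set (F × F)) := by
    ext ⟨r, s⟩
    rw [Set.mem_ofPred_eq, cayley_zero_iff h2]
    simp only [A, B, C, T, T', Finset.mem_coe, Finset.mem_union, Finset.mem_image,
      Finset.mem_compl, Finset.mem_insert, Finset.mem_singleton, not_or, Prod.mk.injEq,
      ← and_assoc, exists_eq_right]
    grind
  rw [hS, Set.ncard_coe_finset, Finset.card_union_of_disjoint hABC,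
    Finset.card_union_of_disjoint hAB, Finset.card_image_of_injective _ (inj _),
    Finset.card_image_of_injective _ (inj _), Finset.card_image_of_injective _ (inj _),
    cardT, cardT']
  omega

/-- The only zeros of `H₃` whose first member is singular are `(0, 2)` and `(1, -1)`. -/
theorem cayley_zero_singular_iff {F : Type*} [Field F] (h2 : (2 : F) ≠ 0) {r s : F}
    (h0 : s ≠ 0) (h1 : s ≠ 1)
    (h : r = s ^ 2 ∨ (s ≠ 2⁻¹ ∧ r = s ^ 2 / (2 * s - 1)) ∨ r = 2 * s - s ^ 2) :
    (r = 0 ∨ r = 1) ↔ (r = 0 ∧ s = 2) ∨ (r = 1 ∧ s = -1) := by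
  refine ⟨?_, fun h => h.imp And.left And.left⟩
  have hs1 : s - 1 ≠ 0 := sub_ne_zero.2 h1
  have hs2 : (s - 1) ^ 2 ≠ 0 := pow_ne_zero 2 hs1
  rcases h with h | ⟨hh, h⟩ | h
  · rintro (rfl | rfl)
    · exact absurd h.symm (pow_ne_zero 2 h0)
    · refine Or.inr ⟨rfl, mul_left_cancel₀ hs1 ?_⟩
      linear_combination -h
  · have hs := (ne_inv_two_iff h2).1 hh
    rintro (rfl | rfl)
    · exact absurd h.symm (div_ne_zero (pow_ne_zero 2 h0) hs)
    · rw [eq_div_iff hs] at h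
      exact absurd (by linear_combination -h) hs2
  · rintro (rfl | rfl)
    · refine Or.inl ⟨rfl, mul_left_cancel₀ h0 ?_⟩
      linear_combination h
    · exact absurd (by linear_combination h) hs2

/-- For the Cayley coefficient `H₃` of the pencil `𝒫₃`, the set `S` of pairs
`(r,s)` with `s ∉ {0,1}`, `r ≠ s` and `(r − s²)((2s−1)r − s²)(r + s² − 2s) = 0` has exactly
`3q − 7` elements, and the subset of `S` with additionally `r ∉ {0,1}` has exactly `3q − 9`
elements. -/
theorem stmt11 {F : Type*} [Field F] [Fintype F]
    (h2 : ringChar F ≠ 2) :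
    {p : F × F | p.2 ≠ 0 ∧ p.2 ≠ 1 ∧ p.1 ≠ p.2 ∧
        (p.1 - p.2 ^ 2) * ((2 * p.2 - 1) * p.1 - p.2 ^ 2) *
          (p.1 + p.2 ^ 2 - 2 * p.2) = 0}.ncard = 3 * Fintype.card F - 7 ∧
    {p : F × F | p.2 ≠ 0 ∧ p.2 ≠ 1 ∧ p.1 ≠ p.2 ∧
        (p.1 - p.2 ^ 2) * ((2 * p.2 - 1) * p.1 - p.2 ^ 2) *
          (p.1 + p.2 ^ 2 - 2 * p.2) = 0 ∧ p.1 ≠ 0 ∧ p.1 ≠ 1}.ncard =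
      3 * Fintype.card F - 9 := by
  have h2' : (2 : F) ≠ 0 := Ring.two_ne_zero h2
  refine ⟨ncard_cayley_zero h2', ?_⟩
  have hne : ((0, 2) : F × F) ≠ (1, -1) := fun h => zero_ne_one (Prod.ext_iff.1 h).1
  have hsub : {((0, 2) : F × F), (1, -1)} ⊆ {p : F × F | p.2 ≠ 0 ∧ p.2 ≠ 1 ∧ p.1 ≠ p.2 ∧
      (p.1 - p.2 ^ 2) * ((2 * p.2 - 1) * p.1 - p.2 ^ 2) *
        (p.1 + p.2 ^ 2 - 2 * p.2) = 0} := by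
    rintro p (rfl | rfl)
    · exact ⟨h2', fun h => one_ne_zero (α := F) (by linear_combination h), h2'.symm, by ring⟩
    · exact ⟨neg_ne_zero.2 one_ne_zero, fun h => h2' (by linear_combination -h),
        fun h => h2' (by linear_combination h), by ring⟩
  have hcard := Set.ncard_sdiff hsub (Set.toFinite _)
  rw [ncard_cayley_zero h2', Set.ncard_pair hne, Nat.sub_sub] at hcard
  rw [← hcard]
  congr 1
  ext ⟨r, s⟩
  simp only [Set.mem_ofPred_eq, Set.mem_sdiff, Set.mem_insert_iff, Set.mem_singleton_iff,
    Prod.mk.injEq]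
  constructor
  · rintro ⟨h0, h1, hrs, h, hr0, hr1⟩
    refine ⟨⟨h0, h1, hrs, h⟩, ?_⟩
    rintro (⟨hr, -⟩ | ⟨hr, -⟩)
    exacts [hr0 hr, hr1 hr]
  · rintro ⟨hS, hr⟩
    obtain ⟨⟨h0, h1⟩, h⟩ := (cayley_zero_iff h2').1 hS
    rw [← cayley_zero_singular_iff h2' h0 h1 h, not_or] at hr
    exact ⟨hS.1, hS.2.1, hS.2.2.1, hS.2.2.2, hr⟩
end

section
/- The set {(r,s) ∈ 𝔽_q × 𝔽_q : r ≠ s and [(2es−1)·r + (−es² + 1)] · [(1−4e)·r² + (8es − 2s)·r + (−e²s⁴ + 2es³ − 6es² + 2s − 1)] = 0} has exactly q − 1 elements. -/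
open Polynomial

/-- An irreducible quadratic `T² + T + e` has no root. -/
theorem sq_add_self_add_ne_zero {F : Type*} [Field F] {e : F}
    (he : Irreducible (X ^ 2 + X + C e : F[X])) (t : F) : t ^ 2 + t + e ≠ 0 := by
  have hdeg : (X ^ 2 + X + C e : F[X]).natDegree = 2 := by compute_degree!
  simpa [IsRoot] using he.not_isRoot_of_natDegree_ne_one (x := t) (by simp [hdeg])

/-- If `T² + T + e` is irreducible, then `e ≠ 0`. -/
theorem ne_zero_of_irreducible {F : Type*} [Field F] {e : F}
    (he : Irreducible (X ^ 2 + X + C e : F[X])) : e ≠ 0 := by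
  simpa using sq_add_self_add_ne_zero he 0

/-- If `T² + T + e` is irreducible, then its discriminant is not a square. -/
theorem sq_ne_discrim {F : Type*} [Field F] (h2 : (2 : F) ≠ 0) {e : F}
    (he : Irreducible (X ^ 2 + X + C e : F[X])) (w : F) : w ^ 2 ≠ 1 - 4 * e := by
  intro hw
  apply sq_add_self_add_ne_zero he ((w - 1) / 2)
  field_simp
  linear_combination hw

/-- The polynomial reciprocal to `T² + T + e`, evaluated at `-s`, does not vanish. -/
theorem mul_sq_sub_add_one_ne_zero {F : Type*} [Field F] {e : F}
    (he : Irreducible (X ^ 2 + X + C e : F[X])) (s : F) : e * s ^ 2 - s + 1 ≠ 0 := by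
  intro hs
  have hs0 : s ≠ 0 := by
    rintro rfl
    simp at hs
  apply sq_add_self_add_ne_zero he (-1 / s)
  field_simp
  linear_combination hs

/-- The quadratic factor equals `(1 - 4e)(r - s)² - (es² - s + 1)²`, hence never vanishes. -/
theorem quadratic_factor_ne_zero {F : Type*} [Field F] (h2 : (2 : F) ≠ 0) {e : F}
    (he : Irreducible (X ^ 2 + X + C e : F[X])) (r s : F) :
    (1 - 4 * e) * r ^ 2 + (8 * e * s - 2 * s) * r +
      (-e ^ 2 * s ^ 4 + 2 * e * s ^ 3 - 6 * e * s ^ 2 + 2 * s - 1) ≠ 0 := by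
  intro h
  have key : (1 - 4 * e) * (r - s) ^ 2 = (e * s ^ 2 - s + 1) ^ 2 := by
    linear_combination h
  have hrs : r - s ≠ 0 := by
    intro h0
    rw [h0] at key
    exact pow_ne_zero 2 (mul_sq_sub_add_one_ne_zero he s) (by linear_combination -key)
  apply sq_ne_discrim h2 he ((e * s ^ 2 - s + 1) / (r - s))
  rw [div_pow, ← key]
  field_simp

/-- Off the diagonal, the linear factor vanishes exactly on the graph of
`s ↦ (es² - 1) / (2es - 1)` over `s ≠ 1 / (2e)`. -/
theorem linear_factor_eq_zero_iff {F : Type*} [Field F] (h2 : (2 : F) ≠ 0) {e : F}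
    (he : Irreducible (X ^ 2 + X + C e : F[X])) (r s : F) :
    (r ≠ s ∧ (2 * e * s - 1) * r + (-e * s ^ 2 + 1) = 0) ↔
      s ≠ (2 * e)⁻¹ ∧ r = (e * s ^ 2 - 1) / (2 * e * s - 1) := by
  have h2e : 2 * e ≠ 0 := mul_ne_zero h2 (ne_zero_of_irreducible he)
  have hs_iff : s = (2 * e)⁻¹ ↔ 2 * e * s - 1 = 0 := by
    rw [← mul_eq_one_iff_eq_inv₀ h2e, sub_eq_zero, mul_comm]
  rw [Ne, Ne, hs_iff]
  constructor
  · rintro ⟨-, h⟩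
    have hd : 2 * e * s - 1 ≠ 0 := by
      intro hd
      apply sq_ne_discrim h2 he 0
      linear_combination 4 * e * h - (4 * e * r - (2 * e * s + 1)) * hd
    exact ⟨hd, by rw [eq_div_iff hd]; linear_combination h⟩
  · rintro ⟨hd, hr⟩
    rw [eq_div_iff hd] at hr
    refine ⟨?_, by linear_combination hr⟩
    rintro rfl
    exact mul_sq_sub_add_one_ne_zero he r (by linear_combination hr)

/-- `T² + T + e` irreducible. The set of pairs `(r,s)` with `r ≠ s` and
`[(2es−1)r + (−es² + 1)]·[(1−4e)r² + (8es − 2s)r + (−e²s⁴ + 2es³ − 6es² + 2s − 1)] = 0`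
has exactly `q − 1` elements. -/
theorem stmt13 {F : Type*} [Field F] [Fintype F]
    (h2 : ringChar F ≠ 2) (e : F)
    (he : Irreducible (X ^ 2 + X + C e : F[X])) :
    {p : F × F | p.1 ≠ p.2 ∧
      ((2 * e * p.2 - 1) * p.1 + (-e * p.2 ^ 2 + 1)) *
        ((1 - 4 * e) * p.1 ^ 2 + (8 * e * p.2 - 2 * p.2) * p.1 +
          (-e ^ 2 * p.2 ^ 4 + 2 * e * p.2 ^ 3 - 6 * e * p.2 ^ 2 + 2 * p.2 - 1)) = 0}.ncard =
      Fintype.card F - 1 := by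
  have two_ne : (2 : F) ≠ 0 := Ring.two_ne_zero h2
  have hset : {p : F × F | p.1 ≠ p.2 ∧
      ((2 * e * p.2 - 1) * p.1 + (-e * p.2 ^ 2 + 1)) *
        ((1 - 4 * e) * p.1 ^ 2 + (8 * e * p.2 - 2 * p.2) * p.1 +
          (-e ^ 2 * p.2 ^ 4 + 2 * e * p.2 ^ 3 - 6 * e * p.2 ^ 2 + 2 * p.2 - 1)) = 0} =
      (fun s : F ↦ ((e * s ^ 2 - 1) / (2 * e * s - 1), s)) '' {(2 * e)⁻¹}ᶜ := by
    ext ⟨r, s⟩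
    simp only [Set.mem_ofPred_eq, mul_eq_zero_iff_right (quadratic_factor_ne_zero two_ne he r s),
      linear_factor_eq_zero_iff two_ne he, Set.mem_image, Set.mem_compl_iff,
      Set.mem_singleton_iff, Prod.mk.injEq]
    constructor
    · rintro ⟨hs, hr⟩
      exact ⟨s, hs, hr.symm, rfl⟩
    · rintro ⟨_, hs, hr, rfl⟩
      exact ⟨hs, hr.symm⟩
  rw [hset, Set.ncard_image_of_injective _ fun _ _ h ↦ congrArg Prod.snd h, Set.ncard_compl,
    Set.ncard_singleton, Nat.card_eq_fintype_card]
end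

section
/- The set {(r,s) ∈ 𝔽_q × 𝔽_q : r ≠ s and [(2νs + ρ)·r + (−νs² + σ²)] · [(ρ² − 4νσ²)·r² + (8νσ² − 2ρ²)s·r + (−ν²s⁴ − 2νρs³ − 6νσ²s² − 2ρσ²s − σ⁴)] = 0} has exactly q − 1 elements. -/
/-- `ν` and `ρ² − 4νσ²` non-squares. The set of pairs `(r,s)` with `r ≠ s` and
`[(2νs + ρ)r + (−νs² + σ²)]·[(ρ² − 4νσ²)r² + (8νσ² − 2ρ²)s·r + (−ν²s⁴ − 2νρs³ − 6νσ²s² − 2ρσ²s − σ⁴)] = 0`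
has exactly `q − 1` elements. -/
theorem stmt14 {F : Type*} [Field F] [Fintype F]
    (h2 : ringChar F ≠ 2) (ν ρ σ : F)
    (hν : ¬ ∃ y : F, ν = y ^ 2)
    (hρ : ¬ ∃ y : F, ρ ^ 2 - 4 * ν * σ ^ 2 = y ^ 2) :
    {p : F × F | p.1 ≠ p.2 ∧
      ((2 * ν * p.2 + ρ) * p.1 + (-ν * p.2 ^ 2 + σ ^ 2)) *
        ((ρ ^ 2 - 4 * ν * σ ^ 2) * p.1 ^ 2 + (8 * ν * σ ^ 2 - 2 * ρ ^ 2) * p.2 * p.1 +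
          (-ν ^ 2 * p.2 ^ 4 - 2 * ν * ρ * p.2 ^ 3 - 6 * ν * σ ^ 2 * p.2 ^ 2 -
            2 * ρ * σ ^ 2 * p.2 - σ ^ 4)) = 0}.ncard =
      Fintype.card F - 1 := by
  have two : (2 : F) ≠ 0 := Ring.two_ne_zero h2
  have hν0 : ν ≠ 0 := fun h => hν ⟨0, by simp [h]⟩
  have quad_ne (s : F) : ν * s ^ 2 + ρ * s + σ ^ 2 ≠ 0 := fun h =>
    hρ ⟨2 * ν * s + ρ, by linear_combination -4 * ν * h⟩
  have lin_ne {s : F} (hs : s ≠ -ρ / (2 * ν)) : 2 * ν * s + ρ ≠ 0 := fun h => hs <| by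
    rw [eq_div_iff (mul_ne_zero two hν0)]
    linear_combination h
  have graph : {p : F × F | p.1 ≠ p.2 ∧
      ((2 * ν * p.2 + ρ) * p.1 + (-ν * p.2 ^ 2 + σ ^ 2)) *
        ((ρ ^ 2 - 4 * ν * σ ^ 2) * p.1 ^ 2 + (8 * ν * σ ^ 2 - 2 * ρ ^ 2) * p.2 * p.1 +
          (-ν ^ 2 * p.2 ^ 4 - 2 * ν * ρ * p.2 ^ 3 - 6 * ν * σ ^ 2 * p.2 ^ 2 -
            2 * ρ * σ ^ 2 * p.2 - σ ^ 4)) = 0} =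
      (fun s : F => ((ν * s ^ 2 - σ ^ 2) / (2 * ν * s + ρ), s)) '' {-ρ / (2 * ν)}ᶜ := by
    ext ⟨r, s⟩
    simp only [Set.mem_ofPred_eq, Set.mem_image, Set.mem_compl_iff, Set.mem_singleton_iff,
      Prod.mk.injEq]
    constructor
    · rintro ⟨hrs, h⟩
      rcases mul_eq_zero.mp h with h | h
      · have hs : s ≠ -ρ / (2 * ν) := by
          intro hs
          rw [eq_div_iff (mul_ne_zero two hν0)] at hs
          refine hρ ⟨0, ?_⟩
          linear_combination -4 * ν * h + (4 * ν * r - 2 * ν * s + ρ) * hs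
        refine ⟨s, hs, ?_, rfl⟩
        rw [div_eq_iff (lin_ne hs)]
        linear_combination -h
      · refine absurd ⟨(ν * s ^ 2 + ρ * s + σ ^ 2) / (r - s), ?_⟩ hρ
        rw [div_pow, eq_div_iff (pow_ne_zero 2 (sub_ne_zero.mpr hrs))]
        linear_combination h
    · rintro ⟨t, ht, hr, rfl⟩
      rw [div_eq_iff (lin_ne ht)] at hr
      refine ⟨?_, mul_eq_zero_of_left (by linear_combination -hr) _⟩
      rintro rfl
      exact quad_ne r (by linear_combination -hr)
  rw [graph, Set.ncard_image_of_injective _ fun a b h => congrArg Prod.snd h,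
    Set.ncard_compl, Set.ncard_singleton, Nat.card_eq_fintype_card]
end

section
/- The following three non-vanishing statements hold: (i) for all r, s ∈ 𝔽_q with r ≠ s, H(r,s) ≠ 0, where H(r,s) = a₃(s)r³ + a₂(s)r² + a₁(s)r + a₀(s) with a₃(s) = s⁶ + 2bs⁵ + 5cs⁴ + 20s³ + (20b − 5c²)s² + (8b² − 2bc² − 4c)s + (4bc − c³ − 8), a₂(s) = bs⁶ + (4b² − 6c)s⁵ + (10bc − 45)s⁴ + (−40b + 20c²)s³ + (−20b² + 5bc² + 30c)s² + (−8bc + 2c³ + 36)s + (4b − c²), a₁(s) = (−b² + 4c)s⁶ + (2b³ − 8bc + 36)s⁵ + (5b²c + 30b − 20c²)s⁴ + (20b² − 40c)s³ + (10bc − 45)s² + (−6b + 4c²)s + c, a₀(s) = (−b³ + 4bc − 8)s⁶ + (−2b²c − 4b + 8c²)s⁵ + (−5b² + 20c)s⁴ + 20s³ + 5bs² + 2cs + 1; (ii) for all r ∈ 𝔽_q, r³ + br² + (−b² + 4c)r + (−b³ + 4bc − 8) ≠ 0; (iii) for all s ∈ 𝔽_q, a₃(s) ≠ 0. Consequently the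 pencil 𝒫₁₈ contains no 4-Poncelet pairs. -/
open Polynomial

/-- The summand `(t - r)(u - s)(v - s)`, signed so that the product over the three cyclic choices of
`t` is the Cayley coefficient of the cubic with roots `t`, `u`, `v`. -/
def cayleyFactor {R : Type*} [CommRing R] (r s t u v : R) : R :=
  (t - r) * (u - s) * (v - s) - (u - r) * (t - s) * (v - s) - (v - r) * (t - s) * (u - s)

/-- The leading coefficient of `cayleyFactor r s t u v` in `r`. -/
def cayleyFactorInfty {R : Type*} [CommRing R] (s t u v : R) : R :=
  (t - s) * (v - s) + (t - s) * (u - s) - (u - s) * (v - s)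

section Roots

variable {R : Type*} [CommRing R] {b c d t u v : R}

theorem prod_cayleyFactor (hb : b = -(t + u + v)) (hc : c = t * u + t * v + u * v)
    (hd : d = -(t * u * v)) (r s : R) :
    cayleyFactor r s t u v * cayleyFactor r s u v t * cayleyFactor r s v t u =
      (s ^ 6 + 2 * b * s ^ 5 + 5 * c * s ^ 4 + 20 * d * s ^ 3 + (20 * b * d - 5 * c ^ 2) * s ^ 2 +
          (8 * b ^ 2 * d - 2 * b * c ^ 2 - 4 * c * d) * s +
          (4 * b * c * d - c ^ 3 - 8 * d ^ 2)) * r ^ 3 +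
        (b * s ^ 6 + (4 * b ^ 2 - 6 * c) * s ^ 5 + (10 * b * c - 45 * d) * s ^ 4 +
          (-40 * b * d + 20 * c ^ 2) * s ^ 3 +
          (-20 * b ^ 2 * d + 5 * b * c ^ 2 + 30 * c * d) * s ^ 2 +
          (-8 * b * c * d + 2 * c ^ 3 + 36 * d ^ 2) * s + (4 * b * d ^ 2 - c ^ 2 * d)) * r ^ 2 +
        ((-b ^ 2 + 4 * c) * s ^ 6 + (2 * b ^ 3 - 8 * b * c + 36 * d) * s ^ 5 +
          (5 * b ^ 2 * c + 30 * b * d - 20 * c ^ 2) * s ^ 4 + (20 * b ^ 2 * d - 40 * c * d) * s ^ 3 +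
          (10 * b * c * d - 45 * d ^ 2) * s ^ 2 + (-6 * b * d ^ 2 + 4 * c ^ 2 * d) * s +
          c * d ^ 2) * r +
        ((-b ^ 3 + 4 * b * c - 8 * d) * s ^ 6 + (-2 * b ^ 2 * c - 4 * b * d + 8 * c ^ 2) * s ^ 5 +
          (-5 * b ^ 2 * d + 20 * c * d) * s ^ 4 + 20 * d ^ 2 * s ^ 3 + 5 * b * d ^ 2 * s ^ 2 +
          2 * c * d ^ 2 * s + d ^ 3) := by
  subst hb hc hd
  unfold cayleyFactor
  ring

theorem prod_cayleyFactorInfty (hb : b = -(t + u + v)) (hc : c = t * u + t * v + u * v)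
    (hd : d = -(t * u * v)) (s : R) :
    cayleyFactorInfty s t u v * cayleyFactorInfty s u v t * cayleyFactorInfty s v t u =
      s ^ 6 + 2 * b * s ^ 5 + 5 * c * s ^ 4 + 20 * d * s ^ 3 + (20 * b * d - 5 * c ^ 2) * s ^ 2 +
        (8 * b ^ 2 * d - 2 * b * c ^ 2 - 4 * c * d) * s +
        (4 * b * c * d - c ^ 3 - 8 * d ^ 2) := by
  subst hb hc hd
  unfold cayleyFactorInfty
  ring

theorem cayleyFactor_eq_quadratic (hb : b = -(t + u + v)) (hc : c = t * u + t * v + u * v)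
    (hd : d = -(t * u * v)) (r s : R) :
    cayleyFactor r s t u v =
      2 * (s - r) * t ^ 2 + 2 * (s - r) * (b + s) * t +
        (d - r * c + 2 * s * c + s ^ 2 * b + r * s ^ 2) := by
  subst hb hc hd
  unfold cayleyFactor
  ring

theorem cayleyFactorInfty_eq_quadratic (hb : b = -(t + u + v)) (hc : c = t * u + t * v + u * v)
    (s : R) :
    cayleyFactorInfty s t u v = -2 * t ^ 2 + -2 * (b + s) * t + (s ^ 2 - c) := by
  subst hb hc
  unfold cayleyFactorInfty
  ring

end Roots

/-- Over an algebraically closed field a monic cubic has three roots (with multiplicity). -/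
theorem IsAlgClosed.exists_cubic_roots {K : Type*} [Field K] [IsAlgClosed K] (b c d : K) :
    ∃ t u v : K, b = -(t + u + v) ∧ c = t * u + t * v + u * v ∧ d = -(t * u * v) := by
  have h1 : (X ^ 3 + C b * X ^ 2 + C c * X + C d : K[X]).degree ≠ 0 := by
    have : (X ^ 3 + C b * X ^ 2 + C c * X + C d : K[X]).degree = 3 := by compute_degree!
    rw [this]; decide
  obtain ⟨t, ht⟩ := IsAlgClosed.exists_root _ h1
  have h2 : (X ^ 2 + C (b + t) * X + C (c + (b + t) * t) : K[X]).degree ≠ 0 := by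
    have : (X ^ 2 + C (b + t) * X + C (c + (b + t) * t) : K[X]).degree = 2 := by compute_degree!
    rw [this]; decide
  obtain ⟨u, hu⟩ := IsAlgClosed.exists_root _ h2
  simp only [IsRoot.def, eval_add, eval_mul, eval_pow, eval_X, eval_C] at ht hu
  refine ⟨t, u, -b - t - u, by ring, ?_, ?_⟩
  · linear_combination hu
  · linear_combination ht - t * hu

/-- A root of an irreducible cubic satisfies no quadratic relation. -/
theorem quadratic_aeval_ne_zero_of_irreducible_cubic {F K : Type*} [Field F] [Field K] [Algebra F K]
    {b c d : F} (hirr : Irreducible (X ^ 3 + C b * X ^ 2 + C c * X + C d : F[X])) {t : K}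
    (ht : aeval t (X ^ 3 + C b * X ^ 2 + C c * X + C d : F[X]) = 0) {m q p : F} (hm : m ≠ 0) :
    aeval t (C m * X ^ 2 + C q * X + C p : F[X]) ≠ 0 := by
  intro h
  have hdeg := degree_quadratic hm (b := q) (c := p)
  have hne : (C m * X ^ 2 + C q * X + C p : F[X]) ≠ 0 := by
    intro h0
    simp [h0] at hdeg
  have hmin := minpoly.eq_of_irreducible_of_monic hirr ht (by monicity!)
  have hle := minpoly.degree_le_of_ne_zero F t hne h
  have h3 : (X ^ 3 + C b * X ^ 2 + C c * X + C d : F[X]).degree = 3 := by compute_degree!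
  rw [← hmin, h3, hdeg] at hle
  exact absurd hle (by decide)

/-- `T³ + bT² + cT + 1` irreducible. The Cayley coefficient `H₃` of the pencil
`𝒫₁₈` never vanishes: (i) `H(r,s) ≠ 0` for all `r ≠ s`; (ii) the value at `(r,∞)` is nonzero
for all `r`; (iii) the value at `(∞,s)` is nonzero for all `s`. -/
theorem stmt15 {F : Type*} [Field F] [Fintype F]
    (h2 : ringChar F ≠ 2) (b c : F)
    (hirr : Irreducible (X ^ 3 + C b * X ^ 2 + C c * X + 1 : F[X])) :
    (∀ r s : F, r ≠ s →
      (s ^ 6 + 2 * b * s ^ 5 + 5 * c * s ^ 4 + 20 * s ^ 3 + (20 * b - 5 * c ^ 2) * s ^ 2 +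
          (8 * b ^ 2 - 2 * b * c ^ 2 - 4 * c) * s + (4 * b * c - c ^ 3 - 8)) * r ^ 3 +
        (b * s ^ 6 + (4 * b ^ 2 - 6 * c) * s ^ 5 + (10 * b * c - 45) * s ^ 4 +
          (-40 * b + 20 * c ^ 2) * s ^ 3 + (-20 * b ^ 2 + 5 * b * c ^ 2 + 30 * c) * s ^ 2 +
          (-8 * b * c + 2 * c ^ 3 + 36) * s + (4 * b - c ^ 2)) * r ^ 2 +
        ((-b ^ 2 + 4 * c) * s ^ 6 + (2 * b ^ 3 - 8 * b * c + 36) * s ^ 5 +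
          (5 * b ^ 2 * c + 30 * b - 20 * c ^ 2) * s ^ 4 + (20 * b ^ 2 - 40 * c) * s ^ 3 +
          (10 * b * c - 45) * s ^ 2 + (-6 * b + 4 * c ^ 2) * s + c) * r +
        ((-b ^ 3 + 4 * b * c - 8) * s ^ 6 + (-2 * b ^ 2 * c - 4 * b + 8 * c ^ 2) * s ^ 5 +
          (-5 * b ^ 2 + 20 * c) * s ^ 4 + 20 * s ^ 3 + 5 * b * s ^ 2 + 2 * c * s + 1) ≠ 0) ∧
    (∀ r : F,
      r ^ 3 + b * r ^ 2 + (-b ^ 2 + 4 * c) * r + (-b ^ 3 + 4 * b * c - 8) ≠ 0) ∧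
    (∀ s : F,
      s ^ 6 + 2 * b * s ^ 5 + 5 * c * s ^ 4 + 20 * s ^ 3 + (20 * b - 5 * c ^ 2) * s ^ 2 +
        (8 * b ^ 2 - 2 * b * c ^ 2 - 4 * c) * s + (4 * b * c - c ^ 3 - 8) ≠ 0) := by
  have htwo : (2 : F) ≠ 0 := Ring.two_ne_zero h2
  rw [← C_1] at hirr
  obtain ⟨K, _, _, _⟩ : ∃ (K : Type _) (_ : Field K) (_ : Algebra F K), IsAlgClosed K :=
    ⟨AlgebraicClosure F, inferInstance, inferInstance, inferInstance⟩
  let ι := algebraMap F K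
  obtain ⟨t, u, v, hb, hc, hd⟩ := IsAlgClosed.exists_cubic_roots (ι b) (ι c) (ι 1)
  have hroot : ∀ {x y z : K}, ι b = -(x + y + z) →
      ι c = x * y + x * z + y * z → ι 1 = -(x * y * z) →
      aeval x (X ^ 3 + C b * X ^ 2 + C c * X + C 1 : F[X]) = 0 := by
    intro x y z hb hc hd
    simp only [map_add, map_mul, map_pow, aeval_X, aeval_C]
    linear_combination x ^ 2 * hb + x * hc + hd
  have hfac : ∀ {r s : F}, r ≠ s → ∀ {x y z : K}, ι b = -(x + y + z) →
      ι c = x * y + x * z + y * z → ι 1 = -(x * y * z) →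
      cayleyFactor (ι r) (ι s) x y z ≠ 0 := by
    intro r s hrs x y z hb hc hd
    have := quadratic_aeval_ne_zero_of_irreducible_cubic hirr (hroot hb hc hd)
      (m := 2 * (s - r)) (q := 2 * (s - r) * (b + s))
      (p := 1 - r * c + 2 * s * c + s ^ 2 * b + r * s ^ 2)
      (mul_ne_zero htwo (sub_ne_zero.2 hrs.symm))
    rw [cayleyFactor_eq_quadratic hb hc hd]
    simpa [ι, map_ofNat (algebraMap F K)] using this
  have hfac' : ∀ (s : F) {x y z : K}, ι b = -(x + y + z) →
      ι c = x * y + x * z + y * z → ι 1 = -(x * y * z) →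
      cayleyFactorInfty (ι s) x y z ≠ 0 := by
    intro s x y z hb hc hd
    have := quadratic_aeval_ne_zero_of_irreducible_cubic hirr (hroot hb hc hd)
      (m := -2) (q := -2 * (b + s)) (p := s ^ 2 - c) (neg_ne_zero.2 htwo)
    rw [cayleyFactorInfty_eq_quadratic hb hc]
    simpa [ι, map_ofNat (algebraMap F K)] using this
  have hb₂ : ι b = -(u + v + t) := by rw [hb]; ring
  have hc₂ : ι c = u * v + u * t + v * t := by rw [hc]; ring
  have hd₂ : ι 1 = -(u * v * t) := by rw [hd]; ring
  have hb₃ : ι b = -(v + t + u) := by rw [hb]; ring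
  have hc₃ : ι c = v * t + v * u + t * u := by rw [hc]; ring
  have hd₃ : ι 1 = -(v * t * u) := by rw [hd]; ring
  refine ⟨fun r s hrs h => ?_, fun r h => ?_, fun s h => ?_⟩
  · refine mul_ne_zero (mul_ne_zero (hfac hrs hb hc hd) (hfac hrs hb₂ hc₂ hd₂))
      (hfac hrs hb₃ hc₃ hd₃) ?_
    rw [prod_cayleyFactor hb hc hd]
    simpa [ι, map_ofNat (algebraMap F K)] using congrArg ι h
  · have hx : aeval (-(r + b) / 2) (X ^ 3 + C b * X ^ 2 + C c * X + C 1 : F[X]) = 0 := by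
      simp only [map_add, map_mul, map_pow, aeval_X, aeval_C, Algebra.algebraMap_self,
        RingHom.id_apply]
      field_simp
      linear_combination -h
    have := quadratic_aeval_ne_zero_of_irreducible_cubic hirr hx
      (q := (r + b) / 2) (p := 0) one_ne_zero
    exact this (by simp; ring)
  · refine mul_ne_zero (mul_ne_zero (hfac' s hb hc hd) (hfac' s hb₂ hc₂ hd₂))
      (hfac' s hb₃ hc₃ hd₃) ?_
    rw [prod_cayleyFactorInfty hb hc hd]
    simpa [ι, map_ofNat (algebraMap F K)] using congrArg ι h
end

section
/- For all r, s ∈ 𝔽_q, (ρ² − 4νσ²)·r² + (8νσ² − 2ρ²)s·r + (−ν²s⁴ − 2νρs³ − 6νσ²s² − 2ρσ²s − σ⁴) ≠ 0. (Indeed, regarded as a quadratic in r, this polynomial has discriminant 4(ρ² − 4νσ²)(νs² + ρs + σ²)², which is a non-square in 𝔽_q for every s ∈ 𝔽_q.) -/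
/-- `ν` and `ρ² − 4νσ²` non-squares. The quadratic factor of `H₃` for the pencil
`𝒫₁₉` never vanishes: for all `r, s ∈ 𝔽_q`,
`(ρ² − 4νσ²)r² + (8νσ² − 2ρ²)s·r + (−ν²s⁴ − 2νρs³ − 6νσ²s² − 2ρσ²s − σ⁴) ≠ 0`. -/
theorem stmt17 {F : Type*} [Field F] [Fintype F]
    (h2 : ringChar F ≠ 2) (ν ρ σ : F)
    (hν : ¬ ∃ y : F, ν = y ^ 2)
    (hρ : ¬ ∃ y : F, ρ ^ 2 - 4 * ν * σ ^ 2 = y ^ 2) :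
    ∀ r s : F,
      (ρ ^ 2 - 4 * ν * σ ^ 2) * r ^ 2 + (8 * ν * σ ^ 2 - 2 * ρ ^ 2) * s * r +
        (-ν ^ 2 * s ^ 4 - 2 * ν * ρ * s ^ 3 - 6 * ν * σ ^ 2 * s ^ 2 -
          2 * ρ * σ ^ 2 * s - σ ^ 4) ≠ 0 := by
  intro r s h
  have key : (ρ ^ 2 - 4 * ν * σ ^ 2) * (r - s) ^ 2 = (ν * s ^ 2 + ρ * s + σ ^ 2) ^ 2 := by
    linear_combination h
  by_cases hrs : r - s = 0
  · have hQ : ν * s ^ 2 + ρ * s + σ ^ 2 = 0 := by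
      rw [hrs] at key
      exact pow_eq_zero_iff two_ne_zero |>.mp (by rw [← key]; ring)
    exact hρ ⟨2 * ν * s + ρ, by linear_combination (-4 * ν) * hQ⟩
  · refine hρ ⟨(ν * s ^ 2 + ρ * s + σ ^ 2) / (r - s), ?_⟩
    rw [div_pow, eq_div_iff (pow_ne_zero 2 hrs), key]
end
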